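/- arXiv:2204.02576 — 2 statements merged into one kernel-verified Lean document; each statement's English description precedes it below -/
import Mathlib

section
/- There exists a real constant C > 0 such that for every ε > 0 one has Σ_{n ≤ x} a(n + a(n)) = C·x + O_ε(x^{3/4 + ε}) as x → ∞, where the implied constant depends only on ε. -/
/-- `abelianCount n` is the number of isomorphism classes of abelian groups of order `n`:
the multiplicative function with `abelianCount (p^α) = P(α)`, the number of partitions of `α`. -/
def abelianCount (n : ℕ) : ℕ :=
  n.factorization.prod fun _ α => Fintype.card (Nat.Partition α)


open Finset in
theorem Nat.Partition.card_restricted_succ_le (n k : ℕ) (h : k + 1 ≤ n) :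
    #(restricted n (· ≤ k + 1)) ≤
      #(restricted n (· ≤ k)) + #(restricted (n - (k + 1)) (· ≤ k + 1)) := by
  have key : restricted n (· ≤ k + 1) ⊆ restricted n (· ≤ k) ∪
      (restricted (n - (k + 1)) (· ≤ k + 1)).image
        (fun q => ((partitionWithPartEquiv (Nat.le_add_left 1 k) h).symm q).1) := by
    intro p hp
    simp only [restricted, mem_filter, mem_univ, true_and, mem_union, mem_image] at hp ⊢
    by_cases hk : k + 1 ∈ p.parts
    · right
      refine ⟨partitionWithPartEquiv (Nat.le_add_left 1 k) h ⟨p, hk⟩, fun i hi => ?_, by simp⟩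
      rw [partitionWithPartEquiv_apply_parts] at hi
      exact hp i (Multiset.mem_of_mem_erase hi)
    · left
      intro i hi
      have := hp i hi
      have : i ≠ k + 1 := fun e => hk (e ▸ hi)
      omega
  exact (card_le_card key).trans ((card_union_le _ _).trans (by gcongr; exact Finset.card_image_le))

open Finset in
theorem Nat.Partition.restricted_le_eq_univ (n k : ℕ) (h : n ≤ k) :
    restricted n (· ≤ k) = univ := by
  ext p
  simp only [restricted, mem_filter, mem_univ, true_and, iff_true]
  exact fun i hi => (p.le_of_mem_parts hi).trans h

open Finset in
/-- Coefficientwise bound of the partition generating function by its Euler product. -/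
theorem Nat.Partition.card_restricted_mul_pow_le {x : ℝ} (hx0 : 0 ≤ x) (hx1 : x < 1) (k n : ℕ) :
    (#(restricted n (· ≤ k)) : ℝ) * x ^ n ≤ ∏ i ∈ range k, (1 - x ^ (i + 1))⁻¹ := by
  induction k generalizing n with
  | zero =>
    have h1 : #(restricted n (· ≤ 0)) ≤ 1 := by
      refine card_le_one.2 fun p hp q hq => ?_
      have parts_zero (p : Partition n) (hp : p ∈ restricted n (· ≤ 0)) : p.parts = 0 := by
        refine Multiset.eq_zero_of_forall_notMem fun i hi => ?_
        have h := (mem_filter.1 hp).2 i hi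
        have := p.parts_pos hi
        omega
      exact Partition.ext ((parts_zero p hp).trans (parts_zero q hq).symm)
    have h2 : (#(restricted n (· ≤ 0)) : ℝ) ≤ 1 := by exact_mod_cast h1
    simpa using mul_le_one₀ h2 (by positivity) (pow_le_one₀ hx0 hx1.le)
  | succ k ih =>
    have hy : x ^ (k + 1) < 1 := pow_lt_one₀ hx0 hx1 (by omega)
    induction n using Nat.strong_induction_on with
    | _ n ihn =>
      rw [prod_range_succ]
      set Q := ∏ i ∈ range k, (1 - x ^ (i + 1))⁻¹
      have hQ0 : 0 ≤ Q := prod_nonneg fun i _ =>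
        inv_nonneg.2 (sub_nonneg.2 (pow_le_one₀ hx0 hx1.le))
      have hy' : 0 < 1 - x ^ (k + 1) := by linarith
      by_cases h : k + 1 ≤ n
      · have h1 : (#(restricted n (· ≤ k + 1)) : ℝ) ≤
            #(restricted n (· ≤ k)) + #(restricted (n - (k + 1)) (· ≤ k + 1)) := by
          exact_mod_cast card_restricted_succ_le n k h
        have h2 := ihn (n - (k + 1)) (by omega)
        rw [prod_range_succ] at h2
        have h3 := ih n
        have h4 : x ^ n = x ^ (n - (k + 1)) * x ^ (k + 1) := by
          rw [← pow_add]; congr 1; omega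
        calc (#(restricted n (· ≤ k + 1)) : ℝ) * x ^ n
            ≤ (#(restricted n (· ≤ k)) + #(restricted (n - (k + 1)) (· ≤ k + 1))) * x ^ n := by
              gcongr
          _ = #(restricted n (· ≤ k)) * x ^ n +
              #(restricted (n - (k + 1)) (· ≤ k + 1)) * x ^ (n - (k + 1)) * x ^ (k + 1) := by
              rw [h4]; ring
          _ ≤ Q + Q * (1 - x ^ (k + 1))⁻¹ * x ^ (k + 1) := by gcongr
          _ = Q * (1 - x ^ (k + 1))⁻¹ := by field_simp; ring
      · have h3 := ih n
        rw [restricted_le_eq_univ n k (by omega)] at h3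
        rw [restricted_le_eq_univ n (k + 1) (by omega)]
        refine h3.trans (le_mul_of_one_le_right hQ0 ?_)
        exact one_le_inv₀ hy' |>.2 (by linarith [pow_nonneg hx0 (k + 1)])

open Finset in
/-- The number of partitions grows subexponentially. -/
theorem Nat.Partition.exists_card_le_mul_pow {b : ℝ} (hb : 1 < b) :
    ∃ A : ℝ, ∀ n : ℕ, (Fintype.card (Nat.Partition n) : ℝ) ≤ A * b ^ n := by
  set x := b⁻¹ with hx
  have hx0 : 0 < x := by positivity
  have hx1 : x < 1 := inv_lt_one_of_one_lt₀ hb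
  refine ⟨Real.exp ((1 - x)⁻¹ * (1 - x)⁻¹), fun n => ?_⟩
  have h := card_restricted_mul_pow_le hx0.le hx1 n n
  rw [restricted_le_eq_univ n n le_rfl, Finset.card_univ] at h
  have hprod : ∏ i ∈ range n, (1 - x ^ (i + 1))⁻¹ ≤ Real.exp ((1 - x)⁻¹ * (1 - x)⁻¹) := by
    calc ∏ i ∈ range n, (1 - x ^ (i + 1))⁻¹
        ≤ ∏ i ∈ range n, Real.exp (x ^ i * (1 - x)⁻¹) := by
          refine prod_le_prod (fun i _ => inv_nonneg.2 (sub_nonneg.2 (pow_le_one₀ hx0.le hx1.le)))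
            fun i _ => ?_
          have h1 : x ^ (i + 1) ≤ x := pow_le_of_le_one hx0.le hx1.le (by omega)
          have h2 : x ^ (i + 1) ≤ x ^ i := pow_le_pow_of_le_one hx0.le hx1.le (by omega)
          have h3 : 0 < 1 - x ^ (i + 1) := by linarith
          have h4 : 0 < 1 - x := by linarith
          calc (1 - x ^ (i + 1))⁻¹ = x ^ (i + 1) * (1 - x ^ (i + 1))⁻¹ + 1 := by
                field_simp; ring
            _ ≤ x ^ i * (1 - x)⁻¹ + 1 := by gcongr
            _ ≤ _ := Real.add_one_le_exp _
      _ = Real.exp ((∑ i ∈ range n, x ^ i) * (1 - x)⁻¹) := by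
          rw [← Real.exp_sum, sum_mul]
      _ ≤ _ := by
          have h4 : 0 < 1 - x := by linarith
          gcongr
          rw [← tsum_geometric_of_lt_one hx0.le hx1]
          exact (summable_geometric_of_lt_one hx0.le hx1).sum_le_tsum _ fun i _ => by positivity
  have hxb : x ^ n * b ^ n = 1 := by
    rw [← mul_pow, hx, inv_mul_cancel₀ (by positivity), one_pow]
  calc (Fintype.card (Nat.Partition n) : ℝ)
      = Fintype.card (Nat.Partition n) * x ^ n * b ^ n := by rw [mul_assoc, hxb, mul_one]
    _ ≤ _ := by gcongr; exact h.trans hprod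

theorem exists_factorization_prod_le_mul_rpow {F : ℕ → ℝ} (hF0 : ∀ α, 0 ≤ F α)
    (hF : ∀ b : ℝ, 1 < b → ∃ A : ℝ, ∀ α, F α ≤ A * b ^ α) {ε : ℝ} (hε : 0 < ε) :
    ∃ C : ℝ, 1 ≤ C ∧ ∀ n : ℕ, n ≠ 0 →
      n.factorization.prod (fun _ α => F α) ≤ C * (n : ℝ) ^ ε := by
  have hb : (1 : ℝ) < 2 ^ ε := Real.one_lt_rpow one_lt_two hε
  set b : ℝ := 2 ^ ε
  obtain ⟨A₀, hA₀⟩ := hF b hb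
  set A := max A₀ 1
  have hA1 : 1 ≤ A := le_max_right _ _
  have hA : ∀ α, F α ≤ A * b ^ α := fun α =>
    (hA₀ α).trans (by gcongr; exact le_max_left _ _)
  set P := ⌈(A * b) ^ ε⁻¹⌉₊
  refine ⟨A ^ P, one_le_pow₀ hA1, fun n hn => ?_⟩
  have hlocal : ∀ p ∈ n.primeFactors, F (n.factorization p) ≤
      (if p < P then A else 1) * ((p : ℝ) ^ n.factorization p) ^ ε := by
    intro p hp
    have hpp := Nat.prime_of_mem_primeFactors hp
    have hα : n.factorization p ≠ 0 := Finsupp.mem_support_iff.1 hp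
    set α := n.factorization p
    have hswap : ((p : ℝ) ^ α) ^ ε = ((p : ℝ) ^ ε) ^ α := by
      rw [← Real.rpow_natCast, ← Real.rpow_natCast, ← Real.rpow_mul (by positivity),
        ← Real.rpow_mul (by positivity), mul_comm]
    rw [hswap]
    split_ifs with h
    · refine (hA α).trans ?_
      gcongr
      exact Real.rpow_le_rpow zero_le_two (by exact_mod_cast hpp.two_le) hε.le
    · calc F α ≤ A * b ^ α := hA α
        _ ≤ A ^ α * b ^ α := by gcongr; exact le_self_pow₀ hA1 hα
        _ = (A * b) ^ α := (mul_pow _ _ _).symm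
        _ ≤ 1 * ((p : ℝ) ^ ε) ^ α := by
          rw [one_mul]
          gcongr
          have h1 : (A * b) ^ ε⁻¹ ≤ p := (Nat.le_ceil _).trans (by exact_mod_cast not_lt.1 h)
          have h2 := Real.rpow_le_rpow (by positivity) h1 hε.le
          rwa [← Real.rpow_mul (by positivity), inv_mul_cancel₀ hε.ne', Real.rpow_one] at h2
  rw [Nat.prod_factorization_eq_prod_primeFactors]
  calc ∏ p ∈ n.primeFactors, F (n.factorization p)
      ≤ ∏ p ∈ n.primeFactors,
          (if p < P then A else 1) * ((p : ℝ) ^ n.factorization p) ^ ε :=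
        Finset.prod_le_prod (fun _ _ => hF0 _) hlocal
    _ = A ^ (n.primeFactors.filter (· < P)).card * (n : ℝ) ^ ε := by
        rw [Finset.prod_mul_distrib, ← Finset.prod_filter, Finset.prod_const,
          Real.finsetProd_rpow _ _ fun _ _ => by positivity]
        congr 2
        exact_mod_cast Nat.prod_factorization_pow_eq_self hn
    _ ≤ A ^ P * (n : ℝ) ^ ε := by
        gcongr
        refine (Finset.card_le_card fun p hp => ?_).trans (Finset.card_range P).le
        exact Finset.mem_range.2 (Finset.mem_filter.1 hp).2

theorem exists_card_divisors_le_mul_rpow {ε : ℝ} (hε : 0 < ε) :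
    ∃ C : ℝ, 1 ≤ C ∧ ∀ n : ℕ, n ≠ 0 → (n.divisors.card : ℝ) ≤ C * (n : ℝ) ^ ε := by
  have hgrowth : ∀ b : ℝ, 1 < b → ∃ A : ℝ, ∀ α : ℕ, (α : ℝ) + 1 ≤ A * b ^ α := by
    intro b hb
    refine ⟨max (b - 1)⁻¹ 1, fun α => ?_⟩
    have hb' : 0 < b - 1 := by linarith
    have h1 := one_add_mul_le_pow (a := b - 1) (by linarith) α
    have h2 : (α : ℝ) * (b - 1) + 1 ≤ b ^ α := by
      rw [add_sub_cancel] at h1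
      linarith
    calc (α : ℝ) + 1 = (b - 1)⁻¹ * (α * (b - 1)) + 1 * 1 := by field_simp
      _ ≤ max (b - 1)⁻¹ 1 * (α * (b - 1)) + max (b - 1)⁻¹ 1 * 1 := by
        gcongr
        · exact le_max_left _ _
        · exact le_max_right _ _
      _ = max (b - 1)⁻¹ 1 * (α * (b - 1) + 1) := by ring
      _ ≤ _ := by gcongr
  obtain ⟨C, hC, h⟩ :=
    exists_factorization_prod_le_mul_rpow (fun α => by positivity) hgrowth hε
  refine ⟨C, hC, fun n hn => le_of_eq_of_le ?_ (h n hn)⟩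
  rw [Nat.card_divisors hn, Nat.prod_factorization_eq_prod_primeFactors]
  push_cast
  rfl

theorem exists_abelianCount_le_mul_rpow {ε : ℝ} (hε : 0 < ε) :
    ∃ C : ℝ, 1 ≤ C ∧ ∀ n : ℕ, n ≠ 0 → (abelianCount n : ℝ) ≤ C * (n : ℝ) ^ ε := by
  obtain ⟨C, hC, h⟩ := exists_factorization_prod_le_mul_rpow
    (F := fun α => (Fintype.card (Nat.Partition α) : ℝ)) (fun α => by positivity)
    (fun b hb => Nat.Partition.exists_card_le_mul_pow hb) hε
  refine ⟨C, hC, fun n hn => le_of_eq_of_le ?_ (h n hn)⟩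
  rw [abelianCount, Nat.prod_factorization_eq_prod_primeFactors,
    Nat.prod_factorization_eq_prod_primeFactors]
  push_cast
  rfl

theorem abelianCount_pos (n : ℕ) : 0 < abelianCount n :=
  Finset.prod_pos (s := n.factorization.support) fun _ _ => Fintype.card_pos

theorem abelianCount_le_self {n : ℕ} (hn : n ≠ 0) : abelianCount n ≤ n := by
  conv_rhs => rw [← Nat.prod_factorization_pow_eq_self hn]
  refine Finset.prod_le_prod' (s := n.factorization.support) (fun p hp => ?_)
  have hpp := Nat.prime_of_mem_primeFactors hp
  calc Fintype.card (Nat.Partition (n.factorization p))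
      ≤ Fintype.card (Composition (n.factorization p)) :=
        Fintype.card_le_of_surjective _ Nat.Partition.ofComposition_surj
    _ = 2 ^ (n.factorization p - 1) := composition_card _
    _ ≤ 2 ^ n.factorization p := Nat.pow_le_pow_right two_pos (Nat.sub_le _ _)
    _ ≤ p ^ n.factorization p := Nat.pow_le_pow_left hpp.two_le _

theorem abelianCount_prime_mul {p n : ℕ} (hp : p.Prime) (hpn : ¬ p ∣ n) :
    abelianCount (p * n) = abelianCount n := by
  have hco : p.Coprime n := (Nat.Prime.coprime_iff_not_dvd hp).2 hpn
  rw [abelianCount, Nat.factorization_mul_of_coprime hco, Finsupp.prod_add_index_of_disjoint,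
    hp.factorization, Finsupp.prod_single_index]
  · simp [abelianCount]
  · simp
  · exact hco.disjoint_primeFactors

/-- Every prime divisor of `n` divides it at least twice. -/
def IsSquarefull (n : ℕ) : Prop := ∀ p : ℕ, p.Prime → p ∣ n → p ^ 2 ∣ n

open Classical in
/-- The squarefull numbers in `[1, N]`. -/
noncomputable def squarefullUpTo (N : ℕ) : Finset ℕ := (Finset.Icc 1 N).filter IsSquarefull

theorem mem_squarefullUpTo {N n : ℕ} :
    n ∈ squarefullUpTo N ↔ (1 ≤ n ∧ n ≤ N) ∧ IsSquarefull n := by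
  simp [squarefullUpTo]

theorem IsSquarefull.exists_eq_sq_mul_cube {n : ℕ} (hn : n ≠ 0) (h : IsSquarefull n) :
    ∃ c s : ℕ, n = c ^ 2 * s ^ 3 := by
  obtain ⟨s, b, hbs, hs⟩ := Nat.sq_mul_squarefree n
  have hb : b ≠ 0 := by rintro rfl; simp at hbs; exact hn hbs.symm
  have hsb : s ∣ b := by
    rw [← Nat.prod_primeFactors_of_squarefree hs, Nat.prod_primeFactors_dvd_iff hb]
    intro p hp
    have hpp := Nat.prime_of_mem_primeFactors hp
    have hps := Nat.dvd_of_mem_primeFactors hp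
    refine Nat.mem_primeFactors.2 ⟨hpp, ?_, hb⟩
    by_contra hpb
    have h2 : p ^ 2 ∣ b ^ 2 * s := hbs ▸ h p hpp (hbs ▸ hps.mul_left _)
    have hco : (p ^ 2).Coprime (b ^ 2) :=
      Nat.Coprime.pow 2 2 ((Nat.Prime.coprime_iff_not_dvd hpp).2 hpb)
    have h3 : p * p ∣ s := by rw [← sq]; exact hco.dvd_of_dvd_mul_left h2
    exact hpp.one_lt.ne' (Nat.isUnit_iff.1 (hs p h3))
  obtain ⟨c, rfl⟩ := hsb
  exact ⟨c, s, by rw [← hbs]; ring⟩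

open Finset in
theorem sum_inv_sqrt_squarefullUpTo_le (N : ℕ) :
    ∑ m ∈ squarefullUpTo N, (√(m : ℝ))⁻¹ ≤ (1 + Real.log N) ^ 2 := by
  have hsub : squarefullUpTo N ⊆
      (Icc 1 N ×ˢ Icc 1 N).image (fun q : ℕ × ℕ => q.1 ^ 2 * q.2 ^ 3) := by
    intro m hm
    obtain ⟨⟨h1, h2⟩, h3⟩ := mem_squarefullUpTo.1 hm
    obtain ⟨c, s, rfl⟩ := h3.exists_eq_sq_mul_cube (by omega)
    have hc : c ≠ 0 := by rintro rfl; simp at h1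
    have hs : s ≠ 0 := by rintro rfl; simp at h1
    have hcp : 0 < c ^ 2 := by positivity
    have hsp : 0 < s ^ 3 := by positivity
    have hc' : c ≤ c ^ 2 * s ^ 3 := (Nat.le_self_pow two_ne_zero c).trans
      (Nat.le_mul_of_pos_right _ hsp)
    have hs' : s ≤ c ^ 2 * s ^ 3 := (Nat.le_self_pow three_ne_zero s).trans
      (Nat.le_mul_of_pos_left _ hcp)
    refine mem_image.2 ⟨(c, s), ?_, rfl⟩
    simp only [mem_product, mem_Icc]
    omega
  have hH : ∑ c ∈ Icc 1 N, (c : ℝ)⁻¹ ≤ 1 + Real.log N := by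
    have := harmonic_le_one_add_log N
    rw [harmonic_eq_sum_Icc] at this
    push_cast at this
    exact this
  calc ∑ m ∈ squarefullUpTo N, (√(m : ℝ))⁻¹
      ≤ ∑ m ∈ (Icc 1 N ×ˢ Icc 1 N).image (fun q : ℕ × ℕ => q.1 ^ 2 * q.2 ^ 3), (√(m : ℝ))⁻¹ :=
        sum_le_sum_of_subset_of_nonneg hsub fun _ _ _ => by positivity
    _ ≤ ∑ q ∈ Icc 1 N ×ˢ Icc 1 N, (√((q.1 ^ 2 * q.2 ^ 3 : ℕ) : ℝ))⁻¹ :=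
        sum_image_le_of_nonneg fun _ _ => by positivity
    _ ≤ ∑ q ∈ Icc 1 N ×ˢ Icc 1 N, (q.1 : ℝ)⁻¹ * (q.2 : ℝ)⁻¹ := by
        refine sum_le_sum fun q hq => ?_
        simp only [mem_product, mem_Icc] at hq
        have h1 : (1 : ℝ) ≤ q.1 := by exact_mod_cast hq.1.1
        have h2 : (1 : ℝ) ≤ q.2 := by exact_mod_cast hq.2.1
        rw [← mul_inv]
        gcongr
        apply Real.le_sqrt_of_sq_le
        push_cast
        rw [mul_pow]
        gcongr
        norm_num
    _ = (∑ c ∈ Icc 1 N, (c : ℝ)⁻¹) ^ 2 := by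
        rw [sum_product, sq, sum_mul_sum]
    _ ≤ _ := by gcongr

theorem exists_sum_inv_sqrt_squarefullUpTo_le {ε : ℝ} (hε : 0 < ε) :
    ∃ C : ℝ, 1 ≤ C ∧ ∀ N : ℕ, N ≠ 0 →
      ∑ m ∈ squarefullUpTo N, (√(m : ℝ))⁻¹ ≤ C * (N : ℝ) ^ ε := by
  refine ⟨(1 + (ε / 2)⁻¹) ^ 2, ?_, fun N hN => (sum_inv_sqrt_squarefullUpTo_le N).trans ?_⟩
  · exact one_le_pow₀ (by linarith [inv_pos.2 (half_pos hε)])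
  · have h1 : (1 : ℝ) ≤ N := by exact_mod_cast Nat.one_le_iff_ne_zero.2 hN
    have h2 := Real.log_le_rpow_div (by positivity : (0 : ℝ) ≤ N) (half_pos hε)
    have h3 : (1 : ℝ) ≤ (N : ℝ) ^ (ε / 2) := Real.one_le_rpow h1 (by positivity)
    have h4 : (N : ℝ) ^ ε = ((N : ℝ) ^ (ε / 2)) ^ 2 := by
      rw [← Real.rpow_natCast, ← Real.rpow_mul (by positivity)]
      congr 1
      push_cast
      ring
    rw [h4, ← mul_pow]
    have h5 : 0 ≤ Real.log N := Real.log_nonneg h1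
    gcongr
    rw [add_mul, one_mul, inv_mul_eq_div]
    gcongr

open ArithmeticFunction in
/-- The Dirichlet convolution of `f` with the Möbius function. -/
def moebiusTransform (f : ℕ → ℝ) (n : ℕ) : ℝ :=
  ∑ x ∈ n.divisorsAntidiagonal, (moebius x.1 : ℝ) * f x.2

theorem sum_divisors_moebiusTransform (f : ℕ → ℝ) {n : ℕ} (hn : n ≠ 0) :
    ∑ d ∈ n.divisors, moebiusTransform f d = f n :=
  ArithmeticFunction.sum_eq_iff_sum_mul_moebius_eq.2 (fun _ _ => rfl) n (Nat.pos_of_ne_zero hn)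

theorem abs_moebiusTransform_le (f : ℕ → ℝ) {n : ℕ} {B : ℝ}
    (hB : ∀ d ∈ n.divisors, |f d| ≤ B) :
    |moebiusTransform f n| ≤ n.divisors.card * B := by
  refine (Finset.abs_sum_le_sum_abs _ _).trans ?_
  rw [← nsmul_eq_mul, ← Finset.sum_const,
    ← Nat.sum_divisorsAntidiagonal (fun _ _ => B) (n := n)]
  refine Finset.sum_le_sum fun x hx => ?_
  have h1 : |(ArithmeticFunction.moebius x.1 : ℝ)| ≤ 1 := by
    exact_mod_cast ArithmeticFunction.abs_moebius_le_one
  rw [abs_mul, ← one_mul B]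
  exact mul_le_mul h1 (hB _ (Nat.snd_mem_divisors_of_mem_antidiagonal hx)) (abs_nonneg _)
    zero_le_one

theorem sum_divisors_prime_mul (F : ℕ → ℝ) {p m : ℕ} (hp : p.Prime) (hpm : ¬ p ∣ m) :
    ∑ d ∈ (p * m).divisors, F d = ∑ d ∈ m.divisors, F d + ∑ d ∈ m.divisors, F (p * d) := by
  have hm : m ≠ 0 := by rintro rfl; simp at hpm
  have hdiv : (p * m).divisors = m.divisors ∪ m.divisors.image (p * ·) := by
    ext d
    simp only [Nat.mem_divisors, Finset.mem_union, Finset.mem_image]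
    constructor
    · rintro ⟨hd, -⟩
      by_cases hpd : p ∣ d
      · obtain ⟨e, rfl⟩ := hpd
        exact Or.inr ⟨e, ⟨Nat.dvd_of_mul_dvd_mul_left hp.pos hd, hm⟩, rfl⟩
      · have hco : d.Coprime p := ((Nat.Prime.coprime_iff_not_dvd hp).2 hpd).symm
        exact Or.inl ⟨hco.dvd_of_dvd_mul_left hd, hm⟩
    · rintro (⟨hd, -⟩ | ⟨e, ⟨he, -⟩, rfl⟩)
      · exact ⟨hd.mul_left p, mul_ne_zero hp.ne_zero hm⟩
      · exact ⟨Nat.mul_dvd_mul_left p he, mul_ne_zero hp.ne_zero hm⟩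
  rw [hdiv, Finset.sum_union, Finset.sum_image]
  · exact fun a _ b _ h => Nat.eq_of_mul_eq_mul_left hp.pos h
  · rw [Finset.disjoint_left]
    intro d hd hd'
    obtain ⟨e, -, rfl⟩ := Finset.mem_image.1 hd'
    exact hpm ((dvd_mul_right p e).trans (Nat.dvd_of_mem_divisors hd))

/-- If `f` is insensitive to primes dividing exactly once, its Möbius transform is supported
on squarefull numbers. -/
theorem moebiusTransform_eq_zero {f : ℕ → ℝ}
    (hf : ∀ p n : ℕ, p.Prime → ¬ p ∣ n → f (p * n) = f n) {n : ℕ} (hn : ¬ IsSquarefull n) :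
    moebiusTransform f n = 0 := by
  simp only [IsSquarefull, not_forall] at hn
  obtain ⟨p, hp, ⟨m, rfl⟩, hp2⟩ := hn
  have hpm : ¬ p ∣ m := fun h => hp2 (by rw [sq]; exact Nat.mul_dvd_mul_left p h)
  have hm : m ≠ 0 := by rintro rfl; simp at hpm
  clear hp2
  induction m using Nat.strong_induction_on with
  | _ m ih =>
    have h1 := sum_divisors_moebiusTransform f (mul_ne_zero hp.ne_zero hm)
    have h2 := sum_divisors_moebiusTransform f hm
    rw [hf p m hp hpm, sum_divisors_prime_mul _ hp hpm, h2, add_eq_left,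
      Finset.sum_eq_single_of_mem m (Nat.mem_divisors_self m hm)] at h1
    · exact h1
    · intro d hd hdm'
      have hdm := Nat.dvd_of_mem_divisors hd
      exact ih d ((Nat.le_of_dvd (Nat.pos_of_ne_zero hm) hdm).lt_of_ne hdm')
        (fun h => hpm (h.trans hdm)) (ne_zero_of_dvd_ne_zero hm hdm)

open Finset in
/-- Möbius inversion restricted to squarefull divisors. -/
theorem sum_squarefullUpTo_moebiusTransform {f : ℕ → ℝ}
    (hf : ∀ p n : ℕ, p.Prime → ¬ p ∣ n → f (p * n) = f n) {n Z : ℕ} (hn : n ≠ 0) (hnZ : n ≤ Z) :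
    ∑ d ∈ squarefullUpTo Z, (if d ∣ n then moebiusTransform f d else 0) = f n := by
  rw [← sum_divisors_moebiusTransform f hn, ← sum_filter]
  refine sum_subset (fun d hd => ?_) (fun d hd hd' => moebiusTransform_eq_zero hf fun h => hd' ?_)
  · exact Nat.mem_divisors.2 ⟨(mem_filter.1 hd).2, hn⟩
  · have hdn := Nat.dvd_of_mem_divisors hd
    have := Nat.pos_of_mem_divisors hd
    have := Nat.le_of_dvd (Nat.pos_of_ne_zero hn) hdn
    exact mem_filter.2 ⟨mem_squarefullUpTo.2 ⟨⟨by omega, by omega⟩, h⟩, hdn⟩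

open Finset in
theorem abs_card_modEq_sub_le (v : ℕ) {r : ℕ} (hr : 0 < r) (N : ℕ) :
    |(#{n ∈ Icc 1 N | n ≡ v [MOD r]} : ℝ) - (r : ℝ)⁻¹ * N| ≤ 1 := by
  have h := Nat.Ioc_filter_modEq_card (a := 0) (b := N) hr v
  have hIoc : Icc 1 N = Ioc 0 N := rfl
  rw [← hIoc] at h
  have hle : ⌊((0 : ℕ) - (v : ℚ)) / (r : ℚ)⌋ ≤ ⌊((N : ℚ) - v) / (r : ℚ)⌋ := by
    gcongr
    exact N.zero_le
  rw [max_eq_left (sub_nonneg.2 hle)] at h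
  have h1 := Int.floor_le (((N : ℚ) - v) / (r : ℚ))
  have h2 := Int.lt_floor_add_one (((N : ℚ) - v) / (r : ℚ))
  have h3 := Int.floor_le ((((0 : ℕ) : ℚ) - v) / (r : ℚ))
  have h4 := Int.lt_floor_add_one ((((0 : ℕ) : ℚ) - v) / (r : ℚ))
  have hq : |(#{n ∈ Icc 1 N | n ≡ v [MOD r]} : ℚ) - (r : ℚ)⁻¹ * N| ≤ 1 := by
    have h' : (#{n ∈ Icc 1 N | n ≡ v [MOD r]} : ℚ) =
      ⌊((N : ℚ) - v) / (r : ℚ)⌋ - ⌊((0 : ℕ) - (v : ℚ)) / (r : ℚ)⌋ := by exact_mod_cast h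
    have e : (r : ℚ)⁻¹ * N = ((N : ℚ) - v) / r - (((0 : ℕ) : ℚ) - v) / r := by
      push_cast
      ring
    rw [h', e, abs_le]
    constructor <;> linarith
  have hr := (Rat.cast_le (K := ℝ)).2 hq
  push_cast at hr
  exact hr

open Finset in
/-- The solutions of `m ∣ n`, `d ∣ n + k` have a density, with uniformly bounded discrepancy. -/
theorem exists_density_dvd_and_dvd_add {m d : ℕ} (hm : 0 < m) (hd : 0 < d) (k : ℕ) :
    ∃ c : ℝ, ∀ N : ℕ, |(#{n ∈ Icc 1 N | m ∣ n ∧ d ∣ n + k} : ℝ) - c * N| ≤ 1 := by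
  by_cases h : ∃ v, m ∣ v ∧ d ∣ v + k
  · obtain ⟨v, hmv, hdv⟩ := h
    refine ⟨((Nat.lcm m d : ℕ) : ℝ)⁻¹, fun N => ?_⟩
    have heq : ∀ n, (m ∣ n ∧ d ∣ n + k) ↔ n ≡ v [MOD Nat.lcm m d] := by
      intro n
      constructor
      · rintro ⟨h1, h2⟩
        refine Nat.mod_lcm (h1.modEq_zero_nat.trans hmv.zero_modEq_nat) ?_
        exact Nat.ModEq.add_right_cancel' k (h2.modEq_zero_nat.trans hdv.zero_modEq_nat)
      · intro h
        refine ⟨(h.dvd_iff (Nat.dvd_lcm_left m d)).2 hmv, ?_⟩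
        exact ((h.add_right k).dvd_iff (Nat.dvd_lcm_right m d)).2 hdv
    simp_rw [heq]
    exact abs_card_modEq_sub_le v (Nat.lcm_pos hm hd) N
  · push Not at h
    refine ⟨0, fun N => ?_⟩
    rw [filter_false_of_mem fun n _ hn => h n hn.1 hn.2]
    simp

open Finset in
theorem exists_abs_sum_mul_sub_le {K U V : Finset ℕ} (hU : ∀ m ∈ U, 0 < m) (hV : ∀ d ∈ V, 0 < d)
    {u : ℕ → ℕ → ℝ} {v : ℕ → ℝ} {A B : ℝ} (hu : ∀ k, ∀ m ∈ U, |u k m| ≤ A)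
    (hv : ∀ d ∈ V, |v d| ≤ B) :
    ∃ M : ℝ, ∀ N : ℕ, |∑ n ∈ Icc 1 N, ∑ k ∈ K, (∑ m ∈ U, if m ∣ n then u k m else 0) *
      (∑ d ∈ V, if d ∣ n + k then v d else 0) - M * N| ≤ #K * (#U * (#V * (A * B))) := by
  have hdens : ∀ k m d : ℕ, ∃ c : ℝ, 0 < m → 0 < d →
      ∀ N : ℕ, |(#{n ∈ Icc 1 N | m ∣ n ∧ d ∣ n + k} : ℝ) - c * N| ≤ 1 := by
    intro k m d
    by_cases h : 0 < m ∧ 0 < d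
    · obtain ⟨c, hc⟩ := exists_density_dvd_and_dvd_add h.1 h.2 k
      exact ⟨c, fun _ _ => hc⟩
    · exact ⟨0, fun h1 h2 => absurd ⟨h1, h2⟩ h⟩
  choose c hc using hdens
  refine ⟨∑ k ∈ K, ∑ m ∈ U, ∑ d ∈ V, u k m * v d * c k m d, fun N => ?_⟩
  have hsum : ∑ n ∈ Icc 1 N, ∑ k ∈ K, (∑ m ∈ U, if m ∣ n then u k m else 0) *
      (∑ d ∈ V, if d ∣ n + k then v d else 0) =
      ∑ k ∈ K, ∑ m ∈ U, ∑ d ∈ V, u k m * v d * #{n ∈ Icc 1 N | m ∣ n ∧ d ∣ n + k} := by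
    rw [sum_comm]
    refine sum_congr rfl fun k _ => ?_
    simp_rw [sum_mul_sum]
    rw [sum_comm]
    refine sum_congr rfl fun m _ => ?_
    rw [sum_comm]
    refine sum_congr rfl fun d _ => ?_
    rw [card_filter, Nat.cast_sum, mul_sum]
    refine sum_congr rfl fun n _ => ?_
    by_cases h1 : m ∣ n <;> by_cases h2 : d ∣ n + k <;> simp [h1, h2]
  rw [hsum]
  simp_rw [sum_mul, ← sum_sub_distrib]
  refine (abs_sum_le_sum_abs _ _).trans ?_
  simp_rw [← nsmul_eq_mul]
  refine sum_le_card_nsmul _ _ _ fun k _ => (abs_sum_le_sum_abs _ _).trans ?_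
  refine sum_le_card_nsmul _ _ _ fun m hm => (abs_sum_le_sum_abs _ _).trans ?_
  refine sum_le_card_nsmul _ _ _ fun d hd => ?_
  have h1 := hc k m d (hU m hm) (hV d hd) N
  have hA := hu k m hm
  have hB := hv d hd
  have hAB0 : 0 ≤ A * B := mul_nonneg ((abs_nonneg _).trans hA) ((abs_nonneg _).trans hB)
  rw [mul_assoc (u k m * v d), ← mul_sub, abs_mul, abs_mul]
  calc |u k m| * |v d| * _ ≤ A * B * 1 := by
        refine mul_le_mul (mul_le_mul hA hB (abs_nonneg _) ?_) h1 (abs_nonneg _) hAB0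
        exact (abs_nonneg _).trans hA
    _ = A * B := mul_one _

open Finset in
theorem abs_sum_dvd_mul_le {U : Finset ℕ} {u w : ℕ → ℝ} {A B : ℝ} {N : ℕ}
    (hu : ∀ m ∈ U, |u m| ≤ A) (hw : ∀ n ∈ Icc 1 N, |w n| ≤ B) (hB : 0 ≤ B) :
    |∑ n ∈ Icc 1 N, (∑ m ∈ U, if m ∣ n then u m else 0) * w n| ≤
      A * B * N * ∑ m ∈ U, (m : ℝ)⁻¹ := by
  calc |∑ n ∈ Icc 1 N, (∑ m ∈ U, if m ∣ n then u m else 0) * w n|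
      ≤ ∑ n ∈ Icc 1 N, (∑ m ∈ U, if m ∣ n then A else 0) * B := by
        refine (abs_sum_le_sum_abs _ _).trans (sum_le_sum fun n hn => ?_)
        rw [abs_mul]
        have h0 : |∑ m ∈ U, if m ∣ n then u m else 0| ≤ ∑ m ∈ U, if m ∣ n then A else 0 := by
          refine (abs_sum_le_sum_abs _ _).trans (sum_le_sum fun m hm => ?_)
          split_ifs
          · exact hu m hm
          · simp
        exact mul_le_mul h0 (hw n hn) (abs_nonneg _) ((abs_nonneg _).trans h0)
    _ = ∑ m ∈ U, A * B * #{n ∈ Icc 1 N | m ∣ n} := by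
        rw [← sum_mul, sum_comm, sum_mul]
        refine sum_congr rfl fun m _ => ?_
        rw [← sum_filter, sum_const, nsmul_eq_mul]
        ring
    _ ≤ ∑ m ∈ U, A * B * (N * (m : ℝ)⁻¹) := by
        refine sum_le_sum fun m hm => ?_
        have hA : 0 ≤ A := (abs_nonneg _).trans (hu m hm)
        have hIoc : Icc 1 N = Ioc 0 N := rfl
        rw [hIoc, Nat.Ioc_filter_dvd_card_eq_div, ← div_eq_mul_inv]
        gcongr
        exact Nat.cast_div_le
    _ = _ := by
        rw [mul_sum]
        exact sum_congr rfl fun m _ => by ring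

open Finset in
theorem card_le_mul_of_sqrt_le {T W : Finset ℕ} (hTW : T ⊆ W) {y L : ℝ} (hy : 0 ≤ y)
    (hT : ∀ m ∈ T, 0 < m ∧ √(m : ℝ) ≤ y) (hL : ∑ m ∈ W, (√(m : ℝ))⁻¹ ≤ L) :
    (#T : ℝ) ≤ y * L := by
  calc (#T : ℝ) = ∑ m ∈ T, 1 := by simp
    _ ≤ ∑ m ∈ T, y * (√(m : ℝ))⁻¹ := by
        refine sum_le_sum fun m hm => ?_
        obtain ⟨h0, h1⟩ := hT m hm
        have : 0 < √(m : ℝ) := Real.sqrt_pos.2 (by exact_mod_cast h0)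
        rw [← div_eq_mul_inv, one_le_div this]
        exact h1
    _ = y * ∑ m ∈ T, (√(m : ℝ))⁻¹ := by rw [mul_sum]
    _ ≤ y * L := by
        gcongr
        exact (sum_le_sum_of_subset_of_nonneg hTW fun _ _ _ => by positivity).trans hL

theorem abelianCount_indicator_prime_mul (k p n : ℕ) (hp : p.Prime) (hpn : ¬ p ∣ n) :
    (if abelianCount (p * n) = k then (1 : ℝ) else 0) = if abelianCount n = k then 1 else 0 := by
  rw [abelianCount_prime_mul hp hpn]

open Finset in
theorem exists_abs_sum_abelianCount_shift_sub_le {X : ℕ} (hX : 1 ≤ X) {L : ℝ} (hL1 : 1 ≤ L)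
    (ha : ∀ n : ℕ, n ≠ 0 → n ≤ 4 * X → (abelianCount n : ℝ) ≤ L)
    (hτ : ∀ n : ℕ, n ≠ 0 → n ≤ 4 * X → (n.divisors.card : ℝ) ≤ L)
    (hσ : ∑ m ∈ squarefullUpTo (4 * X), (√(m : ℝ))⁻¹ ≤ L) :
    ∃ M : ℝ, ∀ N : ℕ, N ≤ 2 * X →
      |∑ n ∈ Icc 1 N, (abelianCount (n + abelianCount n) : ℝ) - M * N| ≤
        4 * L ^ 6 * √(√(X : ℝ)) ^ 3 := by
  set y : ℝ := √(√(X : ℝ)) with hy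
  have hXpos : (0 : ℝ) < X := by exact_mod_cast hX
  have hy0 : 0 < y := Real.sqrt_pos.2 (Real.sqrt_pos.2 hXpos)
  have hy2 : y ^ 2 = √(X : ℝ) := Real.sq_sqrt (Real.sqrt_nonneg _)
  have hy4 : y ^ 4 = X := by
    rw [show y ^ 4 = (y ^ 2) ^ 2 by ring, hy2, Real.sq_sqrt hXpos.le]
  have hL0 : 0 < L := by linarith
  set W := squarefullUpTo (4 * X)
  have hWmem : ∀ m ∈ W, 0 < m ∧ m ≤ 4 * X := fun m hm => (mem_squarefullUpTo.1 hm).1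
  set U := W.filter (fun m => m * m ≤ X)
  set U' := W.filter (fun m => ¬ m * m ≤ X)
  set K := (Icc 1 (2 * X)).image abelianCount
  set φ : ℕ → ℕ → ℝ := fun k n => if abelianCount n = k then 1 else 0 with hφ
  set ψ : ℕ → ℕ → ℝ := fun k => moebiusTransform (φ k)
  set g : ℕ → ℝ := moebiusTransform (fun n => (abelianCount n : ℝ))
  have hψL : ∀ k, ∀ m ∈ W, |ψ k m| ≤ L := fun k m hm => by
    have h1 : |ψ k m| ≤ m.divisors.card * 1 := abs_moebiusTransform_le _ fun d _ => by
      simp only [hφ]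
      split_ifs <;> simp
    rw [mul_one] at h1
    exact h1.trans (hτ m (hWmem m hm).1.ne' (hWmem m hm).2)
  have hgL : ∀ d ∈ W, |g d| ≤ L * L := fun d hd => by
    refine (abs_moebiusTransform_le (B := L) _ fun e he => ?_).trans ?_
    · rw [Nat.abs_cast]
      exact ha e (Nat.pos_of_mem_divisors he).ne'
        ((Nat.divisor_le he).trans (hWmem d hd).2)
    · gcongr
      exact hτ d (hWmem d hd).1.ne' (hWmem d hd).2
  have hKle : ∀ k ∈ K, k ≤ 2 * X := by
    intro k hk
    obtain ⟨n, hn, rfl⟩ := mem_image.1 hk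
    have := mem_Icc.1 hn
    exact (abelianCount_le_self (by omega)).trans this.2
  have hKcard : (#K : ℝ) ≤ L := by
    have hsub : K ⊆ Icc 1 ⌊L⌋₊ := by
      intro k hk
      obtain ⟨n, hn, rfl⟩ := mem_image.1 hk
      have := mem_Icc.1 hn
      exact mem_Icc.2 ⟨abelianCount_pos n, Nat.le_floor (ha n (by omega) (by omega))⟩
    have h1 := card_le_card hsub
    rw [Nat.card_Icc, Nat.add_sub_cancel] at h1
    exact (Nat.cast_le.2 h1).trans (Nat.floor_le hL0.le)
  have hUcard : (#U : ℝ) ≤ y * L := by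
    refine card_le_mul_of_sqrt_le (filter_subset _ _) hy0.le (fun m hm => ?_) hσ
    obtain ⟨hmW, hmX⟩ := mem_filter.1 hm
    refine ⟨(hWmem m hmW).1, Real.sqrt_le_sqrt (Real.le_sqrt_of_sq_le ?_)⟩
    rw [sq]
    exact_mod_cast hmX
  have hWcard : (#W : ℝ) ≤ 2 * y ^ 2 * L := by
    refine card_le_mul_of_sqrt_le subset_rfl (by positivity) (fun m hm => ?_) hσ
    refine ⟨(hWmem m hm).1, Real.sqrt_le_iff.2 ⟨by positivity, ?_⟩⟩
    have : (m : ℝ) ≤ 4 * X := by exact_mod_cast (hWmem m hm).2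
    calc (m : ℝ) ≤ 4 * X := this
      _ = (2 * y ^ 2) ^ 2 := by rw [← hy4]; ring
  have hU'sum : ∑ m ∈ U', (m : ℝ)⁻¹ ≤ y⁻¹ * L := by
    calc ∑ m ∈ U', (m : ℝ)⁻¹ ≤ ∑ m ∈ U', y⁻¹ * (√(m : ℝ))⁻¹ := by
          refine sum_le_sum fun m hm => ?_
          obtain ⟨hmW, hmX⟩ := mem_filter.1 hm
          have hm0 : (0 : ℝ) < m := by exact_mod_cast (hWmem m hmW).1
          have h1 : y ≤ √(m : ℝ) := by
            refine Real.sqrt_le_sqrt (Real.sqrt_le_iff.2 ⟨hm0.le, ?_⟩)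
            rw [sq]
            exact_mod_cast (not_le.1 hmX).le
          rw [← mul_inv]
          gcongr
          calc y * √(m : ℝ) ≤ √(m : ℝ) * √(m : ℝ) := by gcongr
            _ = m := Real.mul_self_sqrt hm0.le
      _ = y⁻¹ * ∑ m ∈ U', (√(m : ℝ))⁻¹ := by rw [mul_sum]
      _ ≤ y⁻¹ * L := by
          gcongr
          exact (sum_le_sum_of_subset_of_nonneg (filter_subset _ _)
            fun _ _ _ => by positivity).trans hσ
  obtain ⟨M, hM⟩ := exists_abs_sum_mul_sub_le (K := K) (U := U) (V := W) (u := ψ) (v := g)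
    (fun m hm => (hWmem m (mem_filter.1 hm).1).1) (fun d hd => (hWmem d hd).1)
    (fun k m hm => hψL k m (mem_filter.1 hm).1) hgL
  refine ⟨M, fun N hN => ?_⟩
  have hdecomp : ∑ n ∈ Icc 1 N, (abelianCount (n + abelianCount n) : ℝ) =
      ∑ n ∈ Icc 1 N, ∑ k ∈ K, (∑ m ∈ U, if m ∣ n then ψ k m else 0) *
        (∑ d ∈ W, if d ∣ n + k then g d else 0) +
      ∑ k ∈ K, ∑ n ∈ Icc 1 N, (∑ m ∈ U', if m ∣ n then ψ k m else 0) *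
        (abelianCount (n + k) : ℝ) := by
    rw [sum_comm (s := K), ← sum_add_distrib]
    refine sum_congr rfl fun n hn => ?_
    rw [mem_Icc] at hn
    rw [← sum_add_distrib]
    have hterm : ∀ k ∈ K, (∑ m ∈ U, if m ∣ n then ψ k m else 0) *
        (∑ d ∈ W, if d ∣ n + k then g d else 0) + (∑ m ∈ U', if m ∣ n then ψ k m else 0) *
        (abelianCount (n + k) : ℝ) =
        if abelianCount n = k then (abelianCount (n + k) : ℝ) else 0 := by
      intro k hk
      have h1 : ∑ d ∈ W, (if d ∣ n + k then g d else 0) = abelianCount (n + k) :=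
        sum_squarefullUpTo_moebiusTransform
          (fun p n hp hpn => by rw [abelianCount_prime_mul hp hpn]) (by omega)
          (by have := hKle k hk; omega)
      have h2 : ∑ m ∈ W, (if m ∣ n then ψ k m else 0) = φ k n :=
        sum_squarefullUpTo_moebiusTransform (abelianCount_indicator_prime_mul k) (by omega)
          (by omega)
      rw [h1, ← add_mul, sum_filter_add_sum_filter_not, h2]
      simp [hφ]
    rw [sum_congr rfl hterm, sum_ite_eq, if_pos]
    exact mem_image_of_mem _ (mem_Icc.2 ⟨hn.1, hn.2.trans hN⟩)
  have htail : |∑ k ∈ K, ∑ n ∈ Icc 1 N, (∑ m ∈ U', if m ∣ n then ψ k m else 0) *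
      (abelianCount (n + k) : ℝ)| ≤ L * (L * L * (2 * y ^ 4) * (y⁻¹ * L)) := by
    have hN' : (N : ℝ) ≤ 2 * y ^ 4 := by rw [hy4]; exact_mod_cast hN
    calc _ ≤ ∑ k ∈ K, |∑ n ∈ Icc 1 N, (∑ m ∈ U', if m ∣ n then ψ k m else 0) *
          (abelianCount (n + k) : ℝ)| := abs_sum_le_sum_abs _ _
      _ ≤ #K • (L * L * (2 * y ^ 4) * (y⁻¹ * L)) := by
          refine sum_le_card_nsmul _ _ _ fun k hk => ?_
          refine (abs_sum_dvd_mul_le (A := L) (B := L) (w := fun n => (abelianCount (n + k) : ℝ))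
            (fun m hm => hψL k m (mem_filter.1 hm).1) (fun n hn => ?_) hL0.le).trans ?_
          · rw [Nat.abs_cast]
            have := mem_Icc.1 hn
            have := hKle k hk
            exact ha _ (by omega) (by omega)
          · gcongr
      _ ≤ _ := by
          rw [nsmul_eq_mul]
          gcongr
  have hmain : (#K : ℝ) * (#U * (#W * (L * (L * L)))) ≤
      L * (y * L * (2 * y ^ 2 * L * (L * (L * L)))) := by gcongr
  rw [hdecomp, add_sub_right_comm]
  calc _ ≤ _ := abs_add_le _ _
    _ ≤ L * (y * L * (2 * y ^ 2 * L * (L * (L * L)))) +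
        L * (L * L * (2 * y ^ 4) * (y⁻¹ * L)) := add_le_add ((hM N).trans hmain) htail
    _ = 2 * L ^ 6 * y ^ 3 + 2 * L ^ 4 * y ^ 3 := by field_simp
    _ ≤ 2 * L ^ 6 * y ^ 3 + 2 * L ^ 6 * y ^ 3 := by
        gcongr
        norm_num
    _ = _ := by ring

open Finset in
theorem exists_dyadic_abs_sum_abelianCount_shift_sub_le {ε : ℝ} (hε : 0 < ε) :
    ∃ B : ℝ, 0 ≤ B ∧ ∀ X : ℕ, 1 ≤ X → ∃ M : ℝ, ∀ N : ℕ, N ≤ 2 * X →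
      |∑ n ∈ Icc 1 N, (abelianCount (n + abelianCount n) : ℝ) - M * N| ≤
        B * (X : ℝ) ^ ((3 : ℝ) / 4 + ε) := by
  have hδ : 0 < ε / 6 := by positivity
  obtain ⟨C₁, hC₁, h₁⟩ := exists_abelianCount_le_mul_rpow hδ
  obtain ⟨C₂, hC₂, h₂⟩ := exists_card_divisors_le_mul_rpow hδ
  obtain ⟨C₃, hC₃, h₃⟩ := exists_sum_inv_sqrt_squarefullUpTo_le hδ
  set C := max C₁ (max C₂ C₃)
  have hC1 : 1 ≤ C := hC₁.trans (le_max_left _ _)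
  refine ⟨4 * C ^ 6 * 4 ^ ε, by positivity, fun X hX => ?_⟩
  have hX1 : (1 : ℝ) ≤ X := by exact_mod_cast hX
  have hbound : ∀ {c : ℝ} {n : ℕ}, c ≤ C → n ≤ 4 * X →
      c * (n : ℝ) ^ (ε / 6) ≤ C * (4 * X : ℝ) ^ (ε / 6) := by
    intro c n hc hn
    have hn' : (n : ℝ) ≤ 4 * X := by exact_mod_cast hn
    gcongr
  obtain ⟨M, hM⟩ := exists_abs_sum_abelianCount_shift_sub_le hX
    (L := C * (4 * X : ℝ) ^ (ε / 6))
    (one_le_mul_of_one_le_of_one_le hC1 (Real.one_le_rpow (by linarith) hδ.le))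
    (fun n hn hnX => (h₁ n hn).trans (hbound (le_max_left _ _) hnX))
    (fun n hn hnX => (h₂ n hn).trans
      (hbound ((le_max_left _ _).trans (le_max_right _ _)) hnX))
    ((h₃ (4 * X) (by omega)).trans (hbound ((le_max_right _ _).trans (le_max_right _ _)) le_rfl))
  refine ⟨M, fun N hN => (hM N hN).trans (le_of_eq ?_)⟩
  have e1 : √(√(X : ℝ)) ^ 3 = (X : ℝ) ^ ((3 : ℝ) / 4) := by
    rw [Real.sqrt_eq_rpow, Real.sqrt_eq_rpow, ← Real.rpow_mul (by positivity),
      ← Real.rpow_natCast, ← Real.rpow_mul (by positivity)]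
    norm_num
  have e2 : ((4 * X : ℝ) ^ (ε / 6)) ^ 6 = 4 ^ ε * (X : ℝ) ^ ε := by
    rw [← Real.rpow_natCast, ← Real.rpow_mul (by positivity), ← Real.mul_rpow (by norm_num)
      (by positivity)]
    congr 1
    push_cast
    ring
  rw [e1, mul_pow, e2, Real.rpow_add (by positivity)]
  ring

/-- Linear approximations on dyadic ranges force the dyadic averages to be geometrically Cauchy. -/
theorem dist_dyadic_average_le {S : ℕ → ℝ} {θ B : ℝ}
    (h : ∀ X : ℕ, 1 ≤ X → ∃ M : ℝ, ∀ N : ℕ, N ≤ 2 * X → |S N - M * N| ≤ B * (X : ℝ) ^ θ) (j : ℕ) :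
    dist (S (2 ^ j) / 2 ^ j) (S (2 ^ (j + 1)) / 2 ^ (j + 1)) ≤
      2 * B * ((2 : ℝ) ^ (θ - 1)) ^ j := by
  obtain ⟨M, hM⟩ := h (2 ^ j) Nat.one_le_two_pow
  have h1 := hM (2 ^ j) (by omega)
  have h2 := hM (2 ^ (j + 1)) (by rw [pow_succ]; omega)
  push_cast at h1 h2
  have hx : (0 : ℝ) < 2 ^ j := by positivity
  set x : ℝ := 2 ^ j with hxdef
  have hr : ((2 : ℝ) ^ (θ - 1)) ^ j = x ^ θ / x := by
    rw [hxdef, ← Real.rpow_natCast (2 ^ (θ - 1)), ← Real.rpow_natCast 2 j,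
      ← Real.rpow_mul zero_le_two, ← Real.rpow_mul zero_le_two, ← Real.rpow_sub two_pos]
    congr 1
    ring
  have hx2 : (2 : ℝ) ^ (j + 1) = 2 * x := by rw [hxdef]; ring
  rw [hx2] at h2 ⊢
  have h3 : |S (2 ^ j) / x - M| ≤ B * x ^ θ / x := by
    rw [div_sub' hx.ne', abs_div, abs_of_pos hx, mul_comm x M]
    gcongr
  have h4 : |S (2 ^ (j + 1)) / (2 * x) - M| ≤ B * x ^ θ / x := by
    have hx' : 0 < 2 * x := by positivity
    rw [div_sub' hx'.ne', abs_div, abs_of_pos hx', mul_comm (2 * x) M]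
    have hB : 0 ≤ B * x ^ θ := (abs_nonneg _).trans h1
    exact div_le_div₀ hB h2 hx (by linarith)
  rw [Real.dist_eq, hr]
  calc |S (2 ^ j) / x - S (2 ^ (j + 1)) / (2 * x)|
      = |(S (2 ^ j) / x - M) - (S (2 ^ (j + 1)) / (2 * x) - M)| := by congr 1; ring
    _ ≤ _ := abs_sub _ _
    _ ≤ B * x ^ θ / x + B * x ^ θ / x := add_le_add h3 h4
    _ = _ := by ring

theorem abs_sub_mul_le_of_dyadic {S : ℕ → ℝ} {θ B c : ℝ} (hθ0 : 0 ≤ θ) (hθ1 : θ < 1)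
    (h : ∀ X : ℕ, 1 ≤ X → ∃ M : ℝ, ∀ N : ℕ, N ≤ 2 * X → |S N - M * N| ≤ B * (X : ℝ) ^ θ)
    (hc : Filter.Tendsto (fun j : ℕ => S (2 ^ j) / 2 ^ j) Filter.atTop (nhds c)) {N : ℕ}
    (hN : 1 ≤ N) :
    |S N - c * N| ≤ (3 * B + 4 * B / (1 - 2 ^ (θ - 1))) * (N : ℝ) ^ θ := by
  have hr1 : (2 : ℝ) ^ (θ - 1) < 1 := Real.rpow_lt_one_of_one_lt_of_neg one_lt_two (by linarith)
  set j := Nat.log 2 N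
  have hjN : 2 ^ j ≤ N := Nat.pow_log_le_self 2 (by omega)
  have hNj : N ≤ 2 * 2 ^ j := by
    rw [mul_comm, ← pow_succ]
    exact (Nat.lt_pow_succ_log_self one_lt_two N).le
  have hdist := dist_le_of_le_geometric_of_tendsto _ _ hr1 (dist_dyadic_average_le h) hc j
  rw [Real.dist_eq] at hdist
  obtain ⟨M, hM⟩ := h (2 ^ j) Nat.one_le_two_pow
  have h1 := hM (2 ^ j) (by omega)
  have h2 := hM N hNj
  push_cast at h1 h2
  have hx : (0 : ℝ) < 2 ^ j := by positivity
  have hxN : (2 : ℝ) ^ j ≤ N := by exact_mod_cast hjN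
  have hNx : (N : ℝ) ≤ 2 * 2 ^ j := by exact_mod_cast hNj
  set x : ℝ := 2 ^ j with hxdef
  have hr : ((2 : ℝ) ^ (θ - 1)) ^ j = x ^ θ / x := by
    rw [hxdef, ← Real.rpow_natCast (2 ^ (θ - 1)), ← Real.rpow_natCast 2 j,
      ← Real.rpow_mul zero_le_two, ← Real.rpow_mul zero_le_two, ← Real.rpow_sub two_pos]
    congr 1
    ring
  rw [hr] at hdist
  have hB : 0 ≤ B := by
    have := (abs_nonneg _).trans h1
    exact nonneg_of_mul_nonneg_left this (by positivity)
  have h3 : |S (2 ^ j) / x - M| ≤ B * x ^ θ / x := by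
    rw [div_sub' hx.ne', abs_div, abs_of_pos hx, mul_comm x M]
    gcongr
  set D := 1 - (2 : ℝ) ^ (θ - 1) with hD
  have hD0 : 0 < D := by linarith
  have h4 : |M - c| ≤ B * x ^ θ / x + 2 * B * (x ^ θ / x) / D := by
    calc |M - c| = |(S (2 ^ j) / x - c) - (S (2 ^ j) / x - M)| := by congr 1; ring
      _ ≤ _ := abs_sub _ _
      _ ≤ 2 * B * (x ^ θ / x) / D + B * x ^ θ / x := add_le_add hdist h3
      _ = _ := add_comm _ _
  calc |S N - c * N| = |(S N - M * N) + (M - c) * N| := by congr 1; ring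
    _ ≤ |S N - M * N| + |(M - c) * N| := abs_add_le _ _
    _ ≤ B * x ^ θ + (B * x ^ θ / x + 2 * B * (x ^ θ / x) / D) * (2 * x) := by
        rw [abs_mul, Nat.abs_cast]
        gcongr
    _ = (3 * B + 4 * B / D) * x ^ θ := by field_simp; ring
    _ ≤ _ := by gcongr

open Filter in
theorem sum_abelianCount_shift :
    ∃ C : ℝ, 0 < C ∧ ∀ ε : ℝ, 0 < ε →
      (fun x : ℝ =>
          (∑ n ∈ Finset.Icc 1 ⌊x⌋₊, (abelianCount (n + abelianCount n) : ℝ)) - C * x)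
        =O[atTop] fun x : ℝ => x ^ ((3 : ℝ) / 4 + ε) := by
  set S : ℕ → ℝ := fun N => ∑ n ∈ Finset.Icc 1 N, (abelianCount (n + abelianCount n) : ℝ)
  obtain ⟨B₀, -, hB₀⟩ :=
    exists_dyadic_abs_sum_abelianCount_shift_sub_le (ε := 1 / 8) (by norm_num)
  obtain ⟨c, hc⟩ := cauchySeq_tendsto_of_complete (cauchySeq_of_le_geometric _ _
    (Real.rpow_lt_one_of_one_lt_of_neg one_lt_two (by norm_num)) (dist_dyadic_average_le hB₀))
  have hSN : ∀ N : ℕ, (N : ℝ) ≤ S N := by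
    intro N
    calc (N : ℝ) = ∑ n ∈ Finset.Icc 1 N, 1 := by simp
      _ ≤ S N := Finset.sum_le_sum fun n _ => by exact_mod_cast abelianCount_pos _
  have hc1 : 1 ≤ c := ge_of_tendsto' hc fun j => by
    rw [one_le_div (by positivity)]
    have h := hSN (2 ^ j)
    push_cast at h
    exact h
  refine ⟨c, by linarith, fun ε hε => ?_⟩
  set η := min ε (1 / 8)
  have hη0 : 0 < η := lt_min hε (by norm_num)
  have hη1 : η ≤ 1 / 8 := min_le_right _ _
  have hηε : η ≤ ε := min_le_left _ _
  obtain ⟨B, hB, h⟩ := exists_dyadic_abs_sum_abelianCount_shift_sub_le hη0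
  set A := 3 * B + 4 * B / (1 - 2 ^ ((3 : ℝ) / 4 + η - 1))
  have hA0 : 0 ≤ A := by
    have : (2 : ℝ) ^ ((3 : ℝ) / 4 + η - 1) < 1 :=
      Real.rpow_lt_one_of_one_lt_of_neg one_lt_two (by linarith)
    have : 0 < 1 - (2 : ℝ) ^ ((3 : ℝ) / 4 + η - 1) := by linarith
    positivity
  refine Asymptotics.IsBigO.of_bound (A + c) ?_
  filter_upwards [eventually_ge_atTop (1 : ℝ)] with x hx
  have hx0 : 0 ≤ x := by linarith
  have hN : 1 ≤ ⌊x⌋₊ := Nat.one_le_floor_iff _ |>.2 hx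
  have h1 := abs_sub_mul_le_of_dyadic (by linarith) (by linarith) h hc hN
  have h2 : (⌊x⌋₊ : ℝ) ≤ x := Nat.floor_le hx0
  have h3 : x < ⌊x⌋₊ + 1 := Nat.lt_floor_add_one x
  have h4 : x ^ ((3 : ℝ) / 4 + η) ≤ x ^ ((3 : ℝ) / 4 + ε) := by gcongr
  have h5 : 1 ≤ x ^ ((3 : ℝ) / 4 + ε) := Real.one_le_rpow hx (by linarith)
  rw [Real.norm_eq_abs, Real.norm_eq_abs, abs_of_nonneg (zero_le_one.trans h5)]
  calc |S ⌊x⌋₊ - c * x| = |(S ⌊x⌋₊ - c * ⌊x⌋₊) + c * (⌊x⌋₊ - x)| := by congr 1; ring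
    _ ≤ |S ⌊x⌋₊ - c * ⌊x⌋₊| + |c * (⌊x⌋₊ - x)| := abs_add_le _ _
    _ ≤ A * x ^ ((3 : ℝ) / 4 + ε) + c * x ^ ((3 : ℝ) / 4 + ε) := by
        refine add_le_add (h1.trans ?_) ?_
        · refine mul_le_mul_of_nonneg_left (le_trans ?_ h4) hA0
          gcongr
        · rw [abs_mul, abs_of_pos (by linarith : 0 < c)]
          refine mul_le_mul_of_nonneg_left (le_trans ?_ h5) (by linarith)
          rw [abs_le]
          constructor <;> linarith
    _ = _ := by ring
end

section
/- There exists a polynomial Q₂(t) of degree 1 with real coefficients such that for every ε > 0 one has Σ_{n ≤ x} d(n + a(n)) = x·Q₂(log x) + O_ε(x^{3/4 + ε}) as x → ∞, where d(m) is the number of positive divisors of m and the implied constant depends only on ε. -/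
namespace DivisorShift

section Growth

lemma card_partition_le_two_pow (n : ℕ) : Fintype.card (Nat.Partition n) ≤ 2 ^ n := by
  calc Fintype.card (Nat.Partition n) ≤ Fintype.card (Composition n) :=
        Fintype.card_le_of_surjective _ Nat.Partition.ofComposition_surj
    _ = 2 ^ (n - 1) := composition_card n
    _ ≤ 2 ^ n := Nat.pow_le_pow_right (by norm_num) (Nat.sub_le n 1)

lemma sum_succ_mul_count_eq {n : ℕ} (p : Nat.Partition n) :
    ∑ i : Fin n, (i.val + 1) * p.parts.count (i.val + 1) = n := by
  have hsub : p.parts.toFinset ⊆ Finset.Icc 1 n := by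
    intro i hi
    rw [Multiset.mem_toFinset] at hi
    exact Finset.mem_Icc.2 ⟨p.parts_pos hi, p.le_of_mem_parts hi⟩
  have h := Finset.sum_multiset_count_of_subset p.parts _ hsub
  rw [p.parts_sum] at h
  conv_rhs => rw [h]
  rw [Fin.sum_univ_eq_sum_range (fun i => (i + 1) * p.parts.count (i + 1)),
    Finset.range_eq_Ico, Finset.sum_Ico_add' (fun i => i * p.parts.count i) 0 n 1]
  exact Finset.sum_congr rfl fun i _ => mul_comm _ _

lemma partition_ext_count {n : ℕ} {p q : Nat.Partition n}
    (h : ∀ i : Fin n, p.parts.count (i.val + 1) = q.parts.count (i.val + 1)) : p = q := by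
  ext i
  rcases Nat.eq_zero_or_pos i with rfl | hi
  · rw [Multiset.count_eq_zero_of_notMem fun h0 => (p.parts_pos h0).ne' rfl,
      Multiset.count_eq_zero_of_notMem fun h0 => (q.parts_pos h0).ne' rfl]
  by_cases hn : i ≤ n
  · simpa [Nat.sub_add_cancel hi] using h ⟨i - 1, by omega⟩
  · rw [Multiset.count_eq_zero_of_notMem fun h0 => hn (p.le_of_mem_parts h0),
      Multiset.count_eq_zero_of_notMem fun h0 => hn (q.le_of_mem_parts h0)]

lemma inv_one_sub_le_exp {r y : ℝ} (hr : r < 1) (hy : 0 ≤ y) (hyr : y ≤ r) :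
    (1 - y)⁻¹ ≤ Real.exp (y / (1 - r)) := by
  have h1 : 0 < 1 - y := by linarith
  have h2 : 0 < 1 - r := by linarith
  calc (1 - y)⁻¹ = y / (1 - y) + 1 := by field_simp; ring
    _ ≤ y / (1 - r) + 1 := by gcongr
    _ ≤ _ := Real.add_one_le_exp _

lemma sum_pow_le {y : ℝ} (hy : 0 ≤ y) (hy1 : y < 1) (s : Finset ℕ) :
    ∑ j ∈ s, y ^ j ≤ (1 - y)⁻¹ := by
  rw [← tsum_geometric_of_lt_one hy hy1]
  exact (summable_geometric_of_lt_one hy hy1).sum_le_tsum _ fun i _ => pow_nonneg hy i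

lemma exists_card_partition_mul_pow_le {r : ℝ} (hr : 0 < r) (hr1 : r < 1) :
    ∃ C : ℝ, ∀ n : ℕ, (Fintype.card (Nat.Partition n) : ℝ) * r ^ n ≤ C := by
  refine ⟨Real.exp ((1 - r)⁻¹ / (1 - r)), fun n => ?_⟩
  let φ : Nat.Partition n → Fin n → ℕ := fun p i => p.parts.count (i.val + 1)
  have hφ : Function.Injective φ := fun p q h => partition_ext_count fun i => congrFun h i
  let w : (Fin n → ℕ) → ℝ := fun f => ∏ i : Fin n, (r ^ (i.val + 1)) ^ f i
  have hw : ∀ p, w (φ p) = r ^ n := by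
    intro p
    simp only [w, φ, ← pow_mul]
    rw [Finset.prod_pow_eq_pow_sum, sum_succ_mul_count_eq]
  have hmem : ∀ p, φ p ∈ Fintype.piFinset fun _ : Fin n => Finset.range (n + 1) := by
    intro p
    rw [Fintype.mem_piFinset]
    intro i
    have h := sum_succ_mul_count_eq p
    have h2 := Finset.single_le_sum (f := fun i : Fin n => (i.val + 1) * p.parts.count (i.val + 1))
      (fun i _ => Nat.zero_le _) (Finset.mem_univ i)
    rw [h] at h2
    rw [Finset.mem_range]
    simp only [φ] at h2 ⊢
    nlinarith [Nat.zero_le (i.val * p.parts.count (i.val + 1))]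
  calc (Fintype.card (Nat.Partition n) : ℝ) * r ^ n = ∑ p : Nat.Partition n, w (φ p) := by
        simp [hw]
    _ = ∑ f ∈ Finset.univ.image φ, w f := by rw [Finset.sum_image fun p _ q _ h => hφ h]
    _ ≤ ∑ f ∈ Fintype.piFinset fun _ : Fin n => Finset.range (n + 1), w f := by
        refine Finset.sum_le_sum_of_subset_of_nonneg ?_ fun f _ _ => by positivity
        intro f hf
        obtain ⟨p, -, rfl⟩ := Finset.mem_image.1 hf
        exact hmem p
    _ = ∏ i : Fin n, ∑ j ∈ Finset.range (n + 1), (r ^ (i.val + 1)) ^ j := by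
        rw [Finset.prod_univ_sum]
    _ ≤ ∏ i : Fin n, Real.exp (r ^ (i.val + 1) / (1 - r)) := by
        refine Finset.prod_le_prod (fun i _ => by positivity) fun i _ => ?_
        have hle : r ^ (i.val + 1) ≤ r := pow_le_of_le_one hr.le hr1.le (by omega)
        exact (sum_pow_le (by positivity) (hle.trans_lt hr1) _).trans
          (inv_one_sub_le_exp hr1 (by positivity) hle)
    _ = Real.exp ((∑ i : Fin n, r ^ (i.val + 1)) / (1 - r)) := by
        rw [← Real.exp_sum, Finset.sum_div]
    _ ≤ Real.exp ((1 - r)⁻¹ / (1 - r)) := by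
        have h1 : 0 < 1 - r := by linarith
        gcongr
        rw [Fin.sum_univ_eq_sum_range (fun i => r ^ (i + 1))]
        refine le_trans (Finset.sum_le_sum fun i _ => ?_) (sum_pow_le hr.le hr1 (Finset.range n))
        exact pow_le_pow_of_le_one hr.le hr1.le (Nat.le_succ i)

lemma exists_prod_factorization_le {B : ℕ → ℝ} (h0 : ∀ k, 0 ≤ B k) (h2 : ∀ k, B k ≤ 2 ^ k)
    (hB : ∀ r : ℝ, 1 < r → ∃ C, ∀ k, B k ≤ C * r ^ k) {ε : ℝ} (hε : 0 < ε) :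
    ∃ C : ℝ, 1 ≤ C ∧ ∀ n : ℕ, 0 < n →
      n.factorization.prod (fun _ k => B k) ≤ C * (n : ℝ) ^ ε := by
  obtain ⟨C₀, hC₀⟩ := hB (2 ^ ε) (Real.one_lt_rpow (by norm_num) hε)
  set C := max 1 C₀ with hC
  have hC1 : 1 ≤ C := le_max_left _ _
  set K := ⌈(2 : ℝ) ^ ε⁻¹⌉₊ with hK
  refine ⟨C ^ K, one_le_pow₀ hC1, fun n hn => ?_⟩
  have hnpow : (n : ℝ) ^ ε = ∏ p ∈ n.factorization.support,
      (((p : ℝ) ^ n.factorization p) ^ ε) := by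
    rw [Real.finsetProd_rpow _ _ fun i _ => by positivity]
    congr 1
    conv_lhs => rw [← Nat.prod_factorization_pow_eq_self hn.ne']
    rw [Finsupp.prod]
    push_cast
    rfl
  have hloc : ∀ p ∈ n.factorization.support, B (n.factorization p) ≤
      (if p < K then C else 1) * ((p : ℝ) ^ n.factorization p) ^ ε := by
    intro p hp
    have hp2 : (2 : ℝ) ≤ p := by
      exact_mod_cast (Nat.prime_of_mem_primeFactors (by simpa using hp)).two_le
    have hrw : ((p : ℝ) ^ n.factorization p) ^ ε = ((p : ℝ) ^ ε) ^ n.factorization p := by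
      rw [← Real.rpow_natCast, ← Real.rpow_natCast, ← Real.rpow_mul (by positivity),
        ← Real.rpow_mul (by positivity), mul_comm]
    rw [hrw]
    split_ifs with hpK
    · calc B (n.factorization p) ≤ C₀ * ((2 : ℝ) ^ ε) ^ n.factorization p := hC₀ _
        _ ≤ C * ((p : ℝ) ^ ε) ^ n.factorization p := by
            gcongr
            exact le_max_right _ _
    · have h2p : (2 : ℝ) ≤ (p : ℝ) ^ ε := by
        have : (2 : ℝ) ^ ε⁻¹ ≤ p := (Nat.le_ceil _).trans (by exact_mod_cast not_lt.1 hpK)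
        calc (2 : ℝ) = ((2 : ℝ) ^ ε⁻¹) ^ ε := by
              rw [← Real.rpow_mul (by norm_num), inv_mul_cancel₀ hε.ne', Real.rpow_one]
          _ ≤ _ := by gcongr
      calc B (n.factorization p) ≤ 2 ^ n.factorization p := h2 _
        _ ≤ 1 * ((p : ℝ) ^ ε) ^ n.factorization p := by rw [one_mul]; gcongr
  have hcount : ∏ p ∈ n.factorization.support, (if p < K then C else 1) ≤ C ^ K := by
    rw [Finset.prod_ite, Finset.prod_const, Finset.prod_const_one, mul_one]
    refine pow_le_pow_right₀ hC1 ?_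
    calc _ ≤ (Finset.range K).card := Finset.card_le_card fun p hp => by
          simpa using (Finset.mem_filter.1 hp).2
      _ = K := Finset.card_range K
  calc n.factorization.prod (fun _ k => B k)
      ≤ ∏ p ∈ n.factorization.support,
        ((if p < K then C else 1) * ((p : ℝ) ^ n.factorization p) ^ ε) :=
        Finset.prod_le_prod (fun _ _ => h0 _) hloc
    _ = (∏ p ∈ n.factorization.support, (if p < K then C else 1)) * (n : ℝ) ^ ε := by
        rw [Finset.prod_mul_distrib, hnpow]
    _ ≤ C ^ K * (n : ℝ) ^ ε := by gcongr

lemma exists_abelianCount_le {ε : ℝ} (hε : 0 < ε) :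
    ∃ C : ℝ, 1 ≤ C ∧ ∀ n : ℕ, 0 < n → (abelianCount n : ℝ) ≤ C * (n : ℝ) ^ ε := by
  obtain ⟨C, hC, h⟩ := exists_prod_factorization_le
    (B := fun k => (Fintype.card (Nat.Partition k) : ℝ)) (fun k => by positivity)
    (fun k => by exact_mod_cast card_partition_le_two_pow k) (fun r hr => by
      obtain ⟨C, hC⟩ := exists_card_partition_mul_pow_le (inv_pos.2 (zero_lt_one.trans hr))
        (inv_lt_one_of_one_lt₀ hr)
      refine ⟨C, fun k => ?_⟩
      have := hC k
      rwa [inv_pow, ← div_eq_mul_inv, div_le_iff₀ (by positivity)] at this) hε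
  refine ⟨C, hC, fun n hn => ?_⟩
  have := h n hn
  simpa [abelianCount, Finsupp.prod] using this

lemma exists_card_divisors_le {ε : ℝ} (hε : 0 < ε) :
    ∃ C : ℝ, 1 ≤ C ∧ ∀ n : ℕ, 0 < n → (n.divisors.card : ℝ) ≤ C * (n : ℝ) ^ ε := by
  obtain ⟨C, hC, h⟩ := exists_prod_factorization_le
    (B := fun k => (k : ℝ) + 1) (fun k => by positivity)
    (fun k => by exact_mod_cast Nat.lt_two_pow_self) (fun r hr => by
      refine ⟨1 + (r - 1)⁻¹, fun k => ?_⟩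
      have hr1 : 0 < r - 1 := sub_pos.2 hr
      have hb := one_add_mul_le_pow (a := r - 1) (by linarith) k
      have h1 : 1 ≤ r ^ k := one_le_pow₀ hr.le
      have h2 : (k : ℝ) ≤ (r - 1)⁻¹ * r ^ k := by
        rw [inv_mul_eq_div, le_div_iff₀ hr1]
        simp only [add_sub_cancel] at hb
        linarith
      linarith) hε
  refine ⟨C, hC, fun n hn => ?_⟩
  have := h n hn
  rw [Nat.card_divisors hn.ne']
  simpa [Finsupp.prod] using this

end Growth

section Squarefull

/-- A natural number is squarefull if the square of each of its prime divisors divides it. -/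
def Squarefull (n : ℕ) : Prop := ∀ p : ℕ, p.Prime → p ∣ n → p ^ 2 ∣ n

lemma Squarefull.exists_sq_mul_cube {n : ℕ} (h : Squarefull n) :
    ∃ a b : ℕ, a ^ 2 * b ^ 3 = n := by
  obtain ⟨b, m, hbm, hb⟩ := Nat.sq_mul_squarefree n
  have hdvd : b ∣ m := by
    rw [← Nat.prod_primeFactors_of_squarefree hb]
    refine Finset.prod_primes_dvd _ (fun p hp => (Nat.prime_of_mem_primeFactors hp).prime)
      fun p hp => ?_
    have hpp := Nat.prime_of_mem_primeFactors hp
    have hpb := Nat.dvd_of_mem_primeFactors hp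
    by_contra hpm
    have hp2 : p ^ 2 ∣ m ^ 2 * b := hbm ▸ h p hpp (hbm ▸ Dvd.dvd.mul_left hpb _)
    have hcop : Nat.Coprime (p ^ 2) (m ^ 2) :=
      Nat.Coprime.pow _ _ ((Nat.Prime.coprime_iff_not_dvd hpp).2 hpm)
    have hp2b := hcop.dvd_of_dvd_mul_left hp2
    rw [pow_two] at hp2b
    exact hpp.one_lt.ne' (Nat.isUnit_iff.1 (hb p hp2b))
  obtain ⟨a, rfl⟩ := hdvd
  exact ⟨a, b, by rw [← hbm]; ring⟩

lemma summable_squarefull_rpow {σ : ℝ} (hσ : 1 / 2 < σ) :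
    Summable ({n : ℕ | 0 < n ∧ Squarefull n}.indicator fun n => (n : ℝ) ^ (-σ)) := by
  rw [← summable_subtype_iff_indicator]
  have hex : ∀ n : {n : ℕ | 0 < n ∧ Squarefull n}, ∃ q : ℕ × ℕ, q.1 ^ 2 * q.2 ^ 3 = n.1 :=
    fun n => by
      obtain ⟨a, b, h⟩ := n.2.2.exists_sq_mul_cube
      exact ⟨(a, b), h⟩
  choose g hg using hex
  have hinj : Function.Injective g := fun m n h => by
    apply Subtype.ext
    rw [← hg m, ← hg n, h]
  have h1 : Summable fun a : ℕ => (a : ℝ) ^ (-(2 * σ)) := Real.summable_nat_rpow.2 (by linarith)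
  have h2 : Summable fun b : ℕ => (b : ℝ) ^ (-(3 * σ)) := Real.summable_nat_rpow.2 (by linarith)
  refine ((h1.mul_of_nonneg h2 (fun _ => by positivity) fun _ => by positivity).comp_injective
    hinj).congr fun n => ?_
  simp only [Function.comp_apply]
  rw [← hg n]
  push_cast
  rw [Real.mul_rpow (by positivity) (by positivity), ← Real.rpow_natCast, ← Real.rpow_natCast,
    ← Real.rpow_mul (by positivity), ← Real.rpow_mul (by positivity)]
  congr 2 <;> push_cast <;> ring

end Squarefull

section AbelianCount

lemma abelianCount_pos (n : ℕ) : 0 < abelianCount n := by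
  rw [abelianCount, Finsupp.prod]
  exact Finset.prod_pos fun _ _ => Fintype.card_pos

lemma abelianCount_mul_of_coprime {m n : ℕ} (h : m.Coprime n) :
    abelianCount (m * n) = abelianCount m * abelianCount n := by
  rw [abelianCount, Nat.factorization_mul_of_coprime h, Finsupp.prod_add_index_of_disjoint]
  · rfl
  · simpa using h.disjoint_primeFactors

lemma abelianCount_prime {p : ℕ} (hp : p.Prime) : abelianCount p = 1 := by
  rw [abelianCount, hp.factorization, Finsupp.prod_single_index] <;> simp

lemma abelianCount_prime_mul {p n : ℕ} (hp : p.Prime) (h : ¬ p ∣ n) :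
    abelianCount (p * n) = abelianCount n := by
  rw [abelianCount_mul_of_coprime ((Nat.Prime.coprime_iff_not_dvd hp).2 h),
    abelianCount_prime hp, one_mul]

lemma abelianCount_of_squarefree {n : ℕ} (hn : Squarefree n) : abelianCount n = 1 := by
  rw [abelianCount, Finsupp.prod]
  refine Finset.prod_eq_one fun p hp => ?_
  have hn0 : n ≠ 0 := hn.ne_zero
  have h1 : n.factorization p = 1 := by
    have h2 := hn.natFactorization_le_one p
    have h3 := Finsupp.mem_support_iff.1 hp
    omega
  simp [h1]

end AbelianCount

section Moebius

open ArithmeticFunction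

/-- The Dirichlet convolution of the Möbius function with `G`. -/
noncomputable def moebiusSum (G : ℕ → ℝ) (n : ℕ) : ℝ :=
  ∑ e ∈ n.divisors, (moebius (n / e) : ℝ) * G e

lemma sum_divisors_moebiusSum (G : ℕ → ℝ) {n : ℕ} (hn : 0 < n) :
    ∑ D ∈ n.divisors, moebiusSum G D = G n := by
  refine (sum_eq_iff_sum_mul_moebius_eq (f := moebiusSum G) (g := G)).2 (fun m _ => ?_) n hn
  rw [Nat.sum_divisorsAntidiagonal' fun i j => (moebius i : ℝ) * G j]
  rfl

lemma abs_moebius_real_le_one (n : ℕ) : |(moebius n : ℝ)| ≤ 1 := by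
  exact_mod_cast abs_moebius_le_one (n := n)

lemma abs_moebiusSum_le (G : ℕ → ℝ) (n : ℕ) :
    |moebiusSum G n| ≤ ∑ e ∈ n.divisors, |G e| := by
  refine (Finset.abs_sum_le_sum_abs _ _).trans (Finset.sum_le_sum fun e _ => ?_)
  rw [abs_mul]
  exact mul_le_of_le_one_left (abs_nonneg _) (abs_moebius_real_le_one _)

lemma moebius_prime_mul {p n : ℕ} (hp : p.Prime) (h : ¬ p ∣ n) :
    moebius (p * n) = -moebius n := by
  rw [isMultiplicative_moebius.map_mul_of_coprime ((Nat.Prime.coprime_iff_not_dvd hp).2 h),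
    moebius_apply_prime hp, neg_one_mul]

lemma moebiusSum_abelianCount_eq_zero (G : ℕ → ℝ) {n : ℕ} (h : ¬ Squarefull n) :
    moebiusSum (fun e => G (abelianCount e)) n = 0 := by
  simp only [Squarefull, not_forall] at h
  obtain ⟨p, hp, ⟨m, rfl⟩, hpn⟩ := h
  have hpm : ¬ p ∣ m := fun hd => hpn (by rw [pow_two]; exact Nat.mul_dvd_mul_left p hd)
  have hdiv : (p * m).divisors = m.divisors ∪ m.divisors.image (p * ·) := by
    rw [Nat.divisors_mul, hp.divisors, Finset.insert_eq, Finset.union_mul,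
      Finset.singleton_mul, Finset.singleton_mul]
    exact congrArg (· ∪ _) (show Finset.image (1 * ·) m.divisors = _ by simp)
  have hdisj : Disjoint m.divisors (m.divisors.image (p * ·)) := by
    rw [Finset.disjoint_left]
    intro e he he'
    obtain ⟨j, -, rfl⟩ := Finset.mem_image.1 he'
    exact hpm ((dvd_mul_right p j).trans (Nat.dvd_of_mem_divisors he))
  rw [moebiusSum, hdiv, Finset.sum_union hdisj,
    Finset.sum_image fun i _ j _ h => Nat.eq_of_mul_eq_mul_left hp.pos h,
    ← Finset.sum_add_distrib]
  refine Finset.sum_eq_zero fun e he => ?_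
  have hem := Nat.dvd_of_mem_divisors he
  rw [Nat.mul_div_assoc p hem, Nat.mul_div_mul_left _ _ hp.pos,
    moebius_prime_mul hp fun hd => hpm (hd.trans (Nat.div_dvd_of_dvd hem)),
    abelianCount_prime_mul hp fun hd => hpm (hd.trans hem)]
  push_cast
  ring

end Moebius

section Reindex

lemma sum_filter_dvd_Icc {M : Type*} [AddCommMonoid M] (f : ℕ → M) {k : ℕ} (hk : 0 < k) (N : ℕ) :
    ∑ a ∈ (Finset.Icc 1 N).filter (k ∣ ·), f a = ∑ j ∈ Finset.Icc 1 (N / k), f (k * j) := by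
  refine (Finset.sum_bij (fun j _ => k * j) (fun j hj => ?_) (fun i _ j _ h => ?_)
    (fun a ha => ?_) fun _ _ => rfl).symm
  · rw [Finset.mem_Icc, Nat.le_div_iff_mul_le hk] at hj
    rw [Finset.mem_filter, Finset.mem_Icc]
    exact ⟨⟨Nat.mul_pos hk hj.1, by linarith⟩, dvd_mul_right _ _⟩
  · exact Nat.eq_of_mul_eq_mul_left hk h
  · rw [Finset.mem_filter, Finset.mem_Icc] at ha
    obtain ⟨⟨h1, h2⟩, j, rfl⟩ := ha
    refine ⟨j, ?_, rfl⟩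
    rw [Finset.mem_Icc, Nat.le_div_iff_mul_le hk]
    exact ⟨Nat.pos_of_mul_pos_left h1, by linarith⟩

lemma sum_Icc_sum_divisors {M : Type*} [AddCommMonoid M] (F : ℕ → ℕ → M) (N : ℕ) :
    ∑ n ∈ Finset.Icc 1 N, ∑ D ∈ n.divisors, F n D =
      ∑ D ∈ Finset.Icc 1 N, ∑ m ∈ Finset.Icc 1 (N / D), F (D * m) D := by
  calc _ = ∑ n ∈ Finset.Icc 1 N, ∑ D ∈ Finset.Icc 1 N, if D ∣ n then F n D else 0 := by
        refine Finset.sum_congr rfl fun n hn => ?_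
        rw [Finset.mem_Icc] at hn
        rw [← Finset.sum_filter]
        refine Finset.sum_congr ?_ fun _ _ => rfl
        ext D
        simp only [Nat.mem_divisors, Finset.mem_filter, Finset.mem_Icc]
        constructor
        · rintro ⟨hd, h0⟩
          exact ⟨⟨Nat.pos_of_dvd_of_pos hd hn.1, (Nat.le_of_dvd hn.1 hd).trans hn.2⟩, hd⟩
        · rintro ⟨-, hd⟩
          exact ⟨hd, by omega⟩
    _ = _ := by
        rw [Finset.sum_comm]
        refine Finset.sum_congr rfl fun D hD => ?_
        rw [← Finset.sum_filter, sum_filter_dvd_Icc (fun n => F n D) (Finset.mem_Icc.1 hD).1]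

end Reindex

section Hyperbola

lemma abs_harmonic_floor_sub_le {t : ℝ} (ht : 1 ≤ t) :
    |(harmonic ⌊t⌋₊ : ℝ) - Real.log t - Real.eulerMascheroniConstant| ≤ 2 / t := by
  set n := ⌊t⌋₊ with hn
  have hn1 : 1 ≤ n := Nat.le_floor (by simpa using ht)
  have hnpos : (0 : ℝ) < n := by exact_mod_cast hn1
  have hnt : (n : ℝ) ≤ t := Nat.floor_le (by linarith)
  have htn : t < n + 1 := Nat.lt_floor_add_one t
  have h1 := Real.eulerMascheroniSeq_lt_eulerMascheroniConstant n
  have h2 := Real.eulerMascheroniConstant_lt_eulerMascheroniSeq' n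
  rw [Real.eulerMascheroniSeq] at h1
  rw [Real.eulerMascheroniSeq', if_neg (by omega)] at h2
  have h3 : Real.log n ≤ Real.log t := Real.log_le_log hnpos hnt
  have h4 : Real.log t ≤ Real.log (n + 1) := Real.log_le_log (by linarith) htn.le
  have h5 : Real.log (n + 1) - Real.log n ≤ 1 / n := by
    rw [← Real.log_div (by positivity) (by positivity)]
    have := Real.log_le_sub_one_of_pos (x := ((n : ℝ) + 1) / n) (by positivity)
    have h6 : ((n : ℝ) + 1) / n - 1 = 1 / n := by field_simp; ring
    linarith
  have h6 : (1 : ℝ) / n ≤ 2 / t := by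
    rw [div_le_div_iff₀ hnpos (by linarith)]
    have : (1 : ℝ) ≤ n := by exact_mod_cast hn1
    linarith
  rw [abs_le]
  constructor <;> linarith

lemma sum_Icc_div_sub_div (t : ℝ) (n : ℕ) :
    ∑ j ∈ Finset.Icc 1 n, (t / j - j / t) =
      t * (harmonic n : ℝ) - ((n : ℝ) * (n + 1) / 2) / t := by
  rw [harmonic_eq_sum_Icc, Finset.sum_sub_distrib, ← Finset.sum_div]
  push_cast
  rw [Finset.mul_sum]
  congr 2
  induction n with
  | zero => simp
  | succ n ih =>
    rw [Finset.sum_Icc_succ_top (by omega), ih]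
    push_cast
    ring

lemma abs_sum_div_sub_div_sub_le {t : ℝ} (ht : 0 < t) :
    |∑ j ∈ Finset.Icc 1 ⌊t⌋₊, (t / j - j / t) -
      t * (Real.log t + Real.eulerMascheroniConstant - 1 / 2)| ≤ 3 := by
  rcases lt_or_ge t 1 with h | h
  · have h0 : ⌊t⌋₊ = 0 := Nat.floor_eq_zero.2 h
    have h1 := Real.abs_log_mul_self_lt t ht h.le
    have h2 := Real.one_half_lt_eulerMascheroniConstant
    have h3 := Real.eulerMascheroniConstant_lt_two_thirds
    rw [h0]
    simp only [zero_lt_one, Finset.Icc_eq_empty_of_lt, Finset.sum_empty]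
    rw [abs_lt] at h1
    rw [abs_le]
    constructor <;> nlinarith
  · rw [sum_Icc_div_sub_div]
    have hH := abs_harmonic_floor_sub_le h
    set n := ⌊t⌋₊
    have hnt : (n : ℝ) ≤ t := Nat.floor_le (by linarith)
    have htn : t < n + 1 := Nat.lt_floor_add_one t
    have hn0 : (0 : ℝ) ≤ n := Nat.cast_nonneg n
    set δ := (harmonic n : ℝ) - Real.log t - Real.eulerMascheroniConstant with hδ
    have hH' : |t * δ| ≤ 2 := by
      rw [abs_mul, abs_of_pos ht]
      calc t * |δ| ≤ t * (2 / t) := by gcongr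
        _ = 2 := by field_simp
    have hq : |((n : ℝ) * (n + 1) / 2) / t - t / 2| ≤ 1 := by
      have : ((n : ℝ) * (n + 1) / 2) / t - t / 2 = ((n : ℝ) * (n + 1) - t ^ 2) / (2 * t) := by
        field_simp
      rw [this, abs_div, abs_of_pos (by positivity : 0 < 2 * t), div_le_one (by positivity),
        abs_le]
      constructor <;> nlinarith
    have key : t * (harmonic n : ℝ) - ((n : ℝ) * (n + 1) / 2) / t -
        t * (Real.log t + Real.eulerMascheroniConstant - 1 / 2) =
        t * δ - (((n : ℝ) * (n + 1) / 2) / t - t / 2) := by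
      rw [hδ]; ring
    rw [key]
    linarith [abs_sub (t * δ) (((n : ℝ) * (n + 1) / 2) / t - t / 2)]

end Hyperbola

section Congruence

/-- The function equal to `g` at the divisors `g` of `c` and to zero elsewhere. -/
noncomputable def divisorWeight (c g : ℕ) : ℝ := if g ∣ c then g else 0

lemma divisorWeight_nonneg (c g : ℕ) : 0 ≤ divisorWeight c g := by
  rw [divisorWeight]; positivity

lemma divisorWeight_le (c g : ℕ) : divisorWeight c g ≤ g := by
  rw [divisorWeight]; split_ifs <;> simp

lemma abs_moebiusSum_divisorWeight_le {c : ℕ} (hc : 0 < c) (k : ℕ) :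
    |moebiusSum (divisorWeight c) k| ≤ (c : ℝ) ^ 2 := by
  calc _ ≤ ∑ g ∈ k.divisors, |divisorWeight c g| := abs_moebiusSum_le _ _
    _ = ∑ g ∈ k.divisors.filter (· ∣ c), (g : ℝ) := by
        rw [Finset.sum_filter]
        refine Finset.sum_congr rfl fun g _ => ?_
        rw [abs_of_nonneg (divisorWeight_nonneg c g), divisorWeight]
    _ ≤ ∑ g ∈ Finset.Icc 1 c, (g : ℝ) := by
        refine Finset.sum_le_sum_of_subset_of_nonneg (fun g hg => ?_) fun _ _ _ => by positivity
        have hgc := (Finset.mem_filter.1 hg).2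
        exact Finset.mem_Icc.2 ⟨Nat.pos_of_dvd_of_pos hgc hc, Nat.le_of_dvd hc hgc⟩
    _ ≤ ∑ g ∈ Finset.Icc 1 c, (c : ℝ) := by
        refine Finset.sum_le_sum fun g hg => ?_
        exact_mod_cast (Finset.mem_Icc.1 hg).2
    _ = (c : ℝ) ^ 2 := by simp [pow_two]

lemma exists_dvd_mul_add_iff_modEq {a D c : ℕ} (ha : 0 < a) (hc : a.gcd D ∣ c) :
    ∃ v : ℕ, ∀ m : ℕ, a ∣ D * m + c ↔ m ≡ v [MOD a / a.gcd D] := by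
  have hg : 0 < a.gcd D := Nat.gcd_pos_of_pos_left D ha
  obtain ⟨a', ha'⟩ := Nat.gcd_dvd_left a D
  obtain ⟨D', hD'⟩ := Nat.gcd_dvd_right a D
  obtain ⟨c', hc'⟩ := hc
  have hquot : a / a.gcd D = a' := Nat.div_eq_of_eq_mul_right hg ha'
  have hquot' : D / a.gcd D = D' := Nat.div_eq_of_eq_mul_right hg hD'
  have hcop : D'.Coprime a' := by
    have := Nat.coprime_div_gcd_div_gcd hg
    rw [hquot, hquot'] at this
    exact this.symm
  have ha0 : a' ≠ 0 := by
    rintro rfl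
    omega
  have : NeZero a' := ⟨ha0⟩
  have hunit : (D' : ZMod a') * (D' : ZMod a')⁻¹ = 1 := ZMod.coe_mul_inv_eq_one D' hcop
  refine ⟨(-(c' : ZMod a') * (D' : ZMod a')⁻¹).val, fun m => ?_⟩
  have h1 : a ∣ D * m + c ↔ a' ∣ D' * m + c' := by
    rw [show D * m + c = a.gcd D * (D' * m + c') by rw [mul_add, ← mul_assoc, ← hD', ← hc']]
    exact (show a ∣ _ ↔ a.gcd D * a' ∣ _ by rw [← ha']).trans (Nat.mul_dvd_mul_iff_left hg)
  rw [h1, hquot, ← ZMod.natCast_eq_natCast_iff, ← ZMod.natCast_eq_zero_iff, ZMod.natCast_zmod_val]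
  push_cast
  constructor
  · intro h
    linear_combination (D' : ZMod a')⁻¹ * h - (m : ZMod a') * hunit
  · intro h
    rw [h]
    linear_combination (-(c' : ZMod a')) * hunit

lemma abs_card_Ioc_modEq_sub_le {u v r : ℕ} (huv : u ≤ v) (hr : 0 < r) (w : ℕ) :
    |(((Finset.Ioc u v).filter (· ≡ w [MOD r])).card : ℝ) - ((v : ℝ) - u) / r| ≤ 1 := by
  have h := Nat.Ioc_filter_modEq_card u v hr w
  have hle : ((u : ℚ) - w) / r ≤ ((v : ℚ) - w) / r := by gcongr
  rw [max_eq_left (sub_nonneg.2 (Int.floor_le_floor hle))] at h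
  have hq : |(((Finset.Ioc u v).filter (· ≡ w [MOD r])).card : ℚ) - ((v : ℚ) - u) / r| ≤ 1 := by
    have h' : (((Finset.Ioc u v).filter (· ≡ w [MOD r])).card : ℚ) =
        (⌊((v : ℚ) - w) / r⌋ : ℚ) - ⌊((u : ℚ) - w) / r⌋ := by exact_mod_cast h
    have h1 := Int.floor_le (((v : ℚ) - w) / r)
    have h2 := Int.lt_floor_add_one (((v : ℚ) - w) / r)
    have h3 := Int.floor_le (((u : ℚ) - w) / r)
    have h4 := Int.lt_floor_add_one (((u : ℚ) - w) / r)
    have h5 : ((v : ℚ) - u) / r = ((v : ℚ) - w) / r - ((u : ℚ) - w) / r := by ring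
    rw [h', h5, abs_le]
    constructor <;> linarith
  have hreal := (Rat.cast_le (K := ℝ)).2 hq
  push_cast at hreal
  exact hreal

lemma abs_card_Ioc_dvd_sub_le {a D u v : ℕ} (ha : 0 < a) (huv : u ≤ v) (c : ℕ) :
    |(((Finset.Ioc u v).filter fun m => a ∣ D * m + c).card : ℝ) -
      ((v : ℝ) - u) * (divisorWeight c (a.gcd D) / a)| ≤ 1 := by
  by_cases hc : a.gcd D ∣ c
  · obtain ⟨w, hw⟩ := exists_dvd_mul_add_iff_modEq ha hc
    have hg : 0 < a.gcd D := Nat.gcd_pos_of_pos_left D ha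
    have hr : 0 < a / a.gcd D := Nat.div_pos (Nat.gcd_le_left D ha) hg
    have h := abs_card_Ioc_modEq_sub_le huv hr w
    rw [Nat.cast_div (Nat.gcd_dvd_left a D) (by positivity)] at h
    simp only [hw]
    rw [divisorWeight, if_pos hc]
    convert h using 3
    field_simp
  · have hempty : ((Finset.Ioc u v).filter fun m => a ∣ D * m + c) = ∅ := by
      refine Finset.filter_eq_empty_iff.2 fun m _ h => hc ?_
      exact (Nat.dvd_add_right (Dvd.dvd.mul_right (Nat.gcd_dvd_right a D) m)).1
        ((Nat.gcd_dvd_left a D).trans h)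
    rw [hempty, divisorWeight, if_neg hc]
    simp

end Congruence

section DivisorPairs

lemma two_mul_card_divisors_sq_lt_le {N t : ℕ} (hN : 0 < N) (ht : t ≤ N) :
    2 * (N.divisors.filter fun a => a ^ 2 < t).card ≤ N.divisors.card := by
  rw [← Finset.card_filter_add_card_filter_not (s := N.divisors) fun a => a ^ 2 < t, two_mul]
  gcongr ?_ + ?_
  · exact le_rfl
  refine Finset.card_le_card_of_injOn (fun a => N / a) (fun a ha => ?_) fun a ha b hb h => ?_
  · simp only [Finset.coe_filter, Set.mem_ofPred_eq, Nat.mem_divisors] at ha ⊢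
    obtain ⟨⟨⟨b, rfl⟩, hN0⟩, hlt⟩ := ha
    have ha0 : 0 < a := Nat.pos_of_mul_pos_right hN
    rw [Nat.mul_div_cancel_left b ha0]
    refine ⟨⟨dvd_mul_left b a, hN0⟩, ?_⟩
    have : a < b := by
      by_contra hba
      nlinarith
    nlinarith
  · simp only [Finset.coe_filter, Set.mem_ofPred_eq, Nat.mem_divisors] at ha hb
    exact (Nat.div_div_self ha.1.1 hN.ne').symm.trans
      ((congrArg (N / ·) h).trans (Nat.div_div_self hb.1.1 hN.ne'))

lemma card_divisors_le_two_mul_card_sq_le {N : ℕ} (hN : 0 < N) :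
    N.divisors.card ≤ 2 * (N.divisors.filter fun a => a ^ 2 ≤ N).card := by
  rw [← Finset.card_filter_add_card_filter_not (s := N.divisors) fun a => a ^ 2 ≤ N, two_mul]
  gcongr ?_ + ?_
  · exact le_rfl
  refine Finset.card_le_card_of_injOn (fun a => N / a) (fun a ha => ?_) fun a ha b hb h => ?_
  · simp only [Finset.coe_filter, Set.mem_ofPred_eq, Nat.mem_divisors] at ha ⊢
    obtain ⟨⟨⟨b, rfl⟩, hN0⟩, hlt⟩ := ha
    have ha0 : 0 < a := Nat.pos_of_mul_pos_right hN
    rw [Nat.mul_div_cancel_left b ha0]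
    refine ⟨⟨dvd_mul_left b a, hN0⟩, ?_⟩
    have : b < a := by
      by_contra hba
      nlinarith
    nlinarith
  · simp only [Finset.coe_filter, Set.mem_ofPred_eq, Nat.mem_divisors] at ha hb
    exact (Nat.div_div_self ha.1.1 hN.ne').symm.trans
      ((congrArg (N / ·) h).trans (Nat.div_div_self hb.1.1 hN.ne'))

end DivisorPairs

section Progression

/-- The sum of the number of divisors of `D * m + c` over the positive `m` with `D * m ≤ x`. -/
noncomputable def divisorSum (D c : ℕ) (x : ℝ) : ℝ :=
  ∑ m ∈ Finset.Icc 1 ⌊x / D⌋₊, ((D * m + c).divisors.card : ℝ)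

/-- The number of pairs `(m, a)` with `1 ≤ m ≤ M`, `a ∣ D * m + c` and `a ^ 2 < D * m`. -/
def smallDivisorCount (D c M : ℕ) : ℕ :=
  ∑ m ∈ Finset.Icc 1 M, ((D * m + c).divisors.filter fun a => a ^ 2 < D * m).card

lemma two_mul_smallDivisorCount_le {D : ℕ} (hD : 0 < D) (c : ℕ) (x : ℝ) :
    2 * (smallDivisorCount D c ⌊x / D⌋₊ : ℝ) ≤ divisorSum D c x := by
  rw [divisorSum, smallDivisorCount]
  norm_cast
  rw [Finset.mul_sum]
  refine Finset.sum_le_sum fun m hm => two_mul_card_divisors_sq_lt_le ?_ (Nat.le_add_right _ _)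
  have := Nat.mul_pos hD (Finset.mem_Icc.1 hm).1
  omega

lemma mul_le_of_mem_Icc_floor_div {D m : ℕ} {x : ℝ} (hD : 0 < D)
    (hm : m ∈ Finset.Icc 1 ⌊x / D⌋₊) : (D : ℝ) * m ≤ x := by
  rw [Finset.mem_Icc] at hm
  have h1 := (Nat.le_floor_iff' (by omega)).1 hm.2
  rw [le_div_iff₀ (by exact_mod_cast hD)] at h1
  linarith

lemma card_filter_mul_le_sq_le {D : ℕ} (hD : 0 < D) (a c M : ℕ) :
    ((Finset.Icc 1 M).filter fun m => D * m ≤ a ^ 2 ∧ a ^ 2 ≤ D * m + c).card ≤ c + 1 := by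
  rw [← Finset.card_range (c + 1)]
  refine Finset.card_le_card_of_injOn (fun m => a ^ 2 - D * m) (fun m hm => ?_)
    fun m hm n hn h => ?_
  · simp only [Finset.coe_filter, Set.mem_ofPred_eq, Finset.coe_range, Set.mem_Iio] at hm ⊢
    omega
  · simp only [Finset.coe_filter, Set.mem_ofPred_eq] at hm hn
    have : D * m = D * n := by
      simp only at h
      omega
    exact Nat.eq_of_mul_eq_mul_left hD this

lemma divisorSum_le {D : ℕ} (hD : 0 < D) (c : ℕ) (x : ℝ) :
    divisorSum D c x ≤ 2 * (smallDivisorCount D c ⌊x / D⌋₊ : ℝ) +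
      2 * ((c + 1) * √(x + c)) := by
  set M := ⌊x / D⌋₊ with hM
  set W := ⌊√(x + c)⌋₊ with hW
  have hsplit : ∀ m ∈ Finset.Icc 1 M, ((D * m + c).divisors.card) ≤
      2 * ((D * m + c).divisors.filter fun a => a ^ 2 < D * m).card +
      2 * ((Finset.Icc 1 W).filter fun a => D * m ≤ a ^ 2 ∧ a ^ 2 ≤ D * m + c).card := by
    intro m hm
    have hpos : 0 < D * m + c := by
      have := Nat.mul_pos hD (Finset.mem_Icc.1 hm).1
      omega
    refine (card_divisors_le_two_mul_card_sq_le hpos).trans ?_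
    rw [← mul_add]
    gcongr
    refine le_trans (Finset.card_le_card fun a ha => ?_) (Finset.card_union_le _ _)
    rw [Finset.mem_filter] at ha
    rw [Finset.mem_union, Finset.mem_filter, Finset.mem_filter, Finset.mem_Icc]
    by_cases hlt : a ^ 2 < D * m
    · exact Or.inl ⟨ha.1, hlt⟩
    · refine Or.inr ⟨⟨Nat.pos_of_mem_divisors ha.1, Nat.le_floor (Real.le_sqrt_of_sq_le ?_)⟩,
        not_lt.1 hlt, ha.2⟩
      have h1 : (a : ℝ) ^ 2 ≤ D * m + c := by exact_mod_cast ha.2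
      linarith [mul_le_of_mem_Icc_floor_div hD hm]
  have hnat : ∑ m ∈ Finset.Icc 1 M, (D * m + c).divisors.card ≤
      2 * smallDivisorCount D c M + 2 * (W * (c + 1)) := by
    calc _ ≤ ∑ m ∈ Finset.Icc 1 M,
          (2 * ((D * m + c).divisors.filter fun a => a ^ 2 < D * m).card +
          2 * ((Finset.Icc 1 W).filter fun a => D * m ≤ a ^ 2 ∧ a ^ 2 ≤ D * m + c).card) :=
          Finset.sum_le_sum hsplit
      _ = 2 * smallDivisorCount D c M + 2 * ∑ a ∈ Finset.Icc 1 W,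
          ((Finset.Icc 1 M).filter fun m => D * m ≤ a ^ 2 ∧ a ^ 2 ≤ D * m + c).card := by
          rw [Finset.sum_add_distrib, ← Finset.mul_sum, ← Finset.mul_sum, smallDivisorCount]
          simp only [Finset.card_filter]
          rw [Finset.sum_comm (s := Finset.Icc 1 M) (t := Finset.Icc 1 W)]
      _ ≤ 2 * smallDivisorCount D c M + 2 * ∑ a ∈ Finset.Icc 1 W, (c + 1) := by
          gcongr with a _
          exact card_filter_mul_le_sq_le hD a c M
      _ = _ := by simp
  have hreal : divisorSum D c x ≤ 2 * (smallDivisorCount D c M : ℝ) + 2 * (W * (c + 1)) := by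
    rw [divisorSum]
    exact_mod_cast hnat
  have hWle : (W : ℝ) ≤ √(x + c) := Nat.floor_le (Real.sqrt_nonneg _)
  calc _ ≤ _ := hreal
    _ ≤ 2 * (smallDivisorCount D c M : ℝ) + 2 * (√(x + c) * (c + 1)) := by gcongr
    _ = _ := by ring

lemma smallDivisorCount_eq {D : ℕ} (hD : 0 < D) (c : ℕ) {x : ℝ} :
    smallDivisorCount D c ⌊x / D⌋₊ = ∑ a ∈ Finset.Icc 1 ⌊√x⌋₊,
      ((Finset.Ioc (a ^ 2 / D) ⌊x / D⌋₊).filter fun m => a ∣ D * m + c).card := by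
  set M := ⌊x / D⌋₊ with hM
  set Z := ⌊√x⌋₊ with hZ
  have h1 : ∀ m ∈ Finset.Icc 1 M, ((D * m + c).divisors.filter fun a => a ^ 2 < D * m) =
      (Finset.Icc 1 Z).filter fun a => a ∣ D * m + c ∧ a ^ 2 < D * m := by
    intro m hm
    have hmx := mul_le_of_mem_Icc_floor_div hD hm
    have := Nat.mul_pos hD (Finset.mem_Icc.1 hm).1
    ext a
    simp only [Finset.mem_filter, Nat.mem_divisors, Finset.mem_Icc]
    constructor
    · rintro ⟨⟨h1, h2⟩, h3⟩
      refine ⟨⟨Nat.pos_of_dvd_of_pos h1 (by omega),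
        Nat.le_floor (Real.le_sqrt_of_sq_le ?_)⟩, h1, h3⟩
      have h4 : (a : ℝ) ^ 2 ≤ D * m := by exact_mod_cast h3.le
      linarith
    · rintro ⟨-, h2, h3⟩
      exact ⟨⟨h2, by omega⟩, h3⟩
  have h2 : ∀ a ∈ Finset.Icc 1 Z,
      ((Finset.Ioc (a ^ 2 / D) M).filter fun m => a ∣ D * m + c) =
      (Finset.Icc 1 M).filter fun m => a ∣ D * m + c ∧ a ^ 2 < D * m := by
    intro a _
    ext m
    simp only [Finset.mem_filter, Finset.mem_Ioc, Finset.mem_Icc, Nat.div_lt_iff_lt_mul hD]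
    rw [mul_comm m D]
    constructor
    · rintro ⟨⟨h1, h2⟩, h3⟩
      refine ⟨⟨?_, h2⟩, h3, h1⟩
      rcases Nat.eq_zero_or_pos m with rfl | hm
      · simp at h1
      · exact hm
    · rintro ⟨⟨_, h2⟩, h3, h4⟩
      exact ⟨⟨h4, h2⟩, h3⟩
  rw [smallDivisorCount, Finset.sum_congr rfl fun m hm => congrArg Finset.card (h1 m hm),
    Finset.sum_congr rfl fun a ha => congrArg Finset.card (h2 a ha)]
  simp only [Finset.card_filter]
  rw [Finset.sum_comm]

lemma abs_smallDivisorCount_sub_le {D : ℕ} (hD : 0 < D) (c : ℕ) {x : ℝ} (hx : 0 ≤ x) :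
    |(smallDivisorCount D c ⌊x / D⌋₊ : ℝ) -
      (1 / D) * ∑ a ∈ Finset.Icc 1 ⌊√x⌋₊, divisorWeight c (a.gcd D) * (x / a - a)| ≤
      2 * √x := by
  have hDpos : (0 : ℝ) < D := by exact_mod_cast hD
  rw [smallDivisorCount_eq hD, Finset.mul_sum]
  push_cast
  rw [← Finset.sum_sub_distrib]
  have hterm : ∀ a ∈ Finset.Icc 1 ⌊√x⌋₊,
      |(((Finset.Ioc (a ^ 2 / D) ⌊x / D⌋₊).filter fun m => a ∣ D * m + c).card : ℝ) -
        (1 / D) * (divisorWeight c (a.gcd D) * (x / a - a))| ≤ 2 := by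
    intro a ha
    rw [Finset.mem_Icc] at ha
    have hapos : (0 : ℝ) < a := by exact_mod_cast ha.1
    have hax : (a : ℝ) ^ 2 ≤ x := by
      have : (a : ℝ) ≤ √x := (Nat.le_floor_iff (Real.sqrt_nonneg x)).1 ha.2
      exact (Real.le_sqrt hapos.le hx).1 this
    have hfloor : a ^ 2 / D = ⌊(a : ℝ) ^ 2 / D⌋₊ := by
      have := Nat.floor_div_eq_div (K := ℝ) (a ^ 2) D
      push_cast at this
      exact this.symm
    have hle : a ^ 2 / D ≤ ⌊x / D⌋₊ := by
      rw [hfloor]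
      gcongr
    have h1 := abs_card_Ioc_dvd_sub_le (D := D) ha.1 hle c
    have hw : divisorWeight c (a.gcd D) / a ≤ 1 := by
      rw [div_le_one hapos]
      refine (divisorWeight_le _ _).trans ?_
      exact_mod_cast Nat.gcd_le_left D ha.1
    have hw0 : 0 ≤ divisorWeight c (a.gcd D) / a := div_nonneg (divisorWeight_nonneg _ _) hapos.le
    have h2 : |((⌊x / D⌋₊ : ℝ) - ((a ^ 2 / D : ℕ) : ℝ)) - (x / D - (a : ℝ) ^ 2 / D)| ≤ 1 := by
      rw [hfloor]
      have h3 := Nat.floor_le (a := x / D) (by positivity)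
      have h4 := Nat.lt_floor_add_one (x / D)
      have h5 := Nat.floor_le (a := (a : ℝ) ^ 2 / D) (by positivity)
      have h6 := Nat.lt_floor_add_one ((a : ℝ) ^ 2 / D)
      rw [abs_le]
      constructor <;> linarith
    have h3 : (1 / D) * (divisorWeight c (a.gcd D) * (x / a - a)) =
        (x / D - (a : ℝ) ^ 2 / D) * (divisorWeight c (a.gcd D) / a) := by
      field_simp
    have h4 : |((⌊x / D⌋₊ : ℝ) - ((a ^ 2 / D : ℕ) : ℝ)) * (divisorWeight c (a.gcd D) / a) -
        (x / D - (a : ℝ) ^ 2 / D) * (divisorWeight c (a.gcd D) / a)| ≤ 1 := by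
      rw [← sub_mul, abs_mul, abs_of_nonneg hw0]
      exact mul_le_one₀ h2 hw0 hw
    rw [h3]
    refine (abs_sub_le _ _ _).trans ((add_le_add h1 h4).trans (by norm_num))
  calc _ ≤ ∑ a ∈ Finset.Icc 1 ⌊√x⌋₊, (2 : ℝ) :=
        (Finset.abs_sum_le_sum_abs _ _).trans (Finset.sum_le_sum hterm)
    _ = 2 * (⌊√x⌋₊ : ℝ) := by simp [mul_comm]
    _ ≤ 2 * √x := by
        gcongr
        exact Nat.floor_le (Real.sqrt_nonneg x)

/-- The coefficient of `x * log x` in the main term for `divisorSum D c x`. -/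
noncomputable def logCoeff (D c : ℕ) : ℝ :=
  (1 / D) * ∑ k ∈ D.divisors, moebiusSum (divisorWeight c) k / k

/-- The coefficient of `x` in the main term for `divisorSum D c x`. -/
noncomputable def linCoeff (D c : ℕ) : ℝ :=
  (2 / D) * ∑ k ∈ D.divisors, moebiusSum (divisorWeight c) k / k *
    (Real.eulerMascheroniConstant - 1 / 2 - Real.log k)

lemma sum_divisorWeight_gcd_eq {D : ℕ} (hD : 0 < D) (c : ℕ) {x : ℝ} (hx : 0 < x) :
    ∑ a ∈ Finset.Icc 1 ⌊√x⌋₊, divisorWeight c (a.gcd D) * (x / a - a) =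
      ∑ k ∈ D.divisors, moebiusSum (divisorWeight c) k *
        (√x * ∑ j ∈ Finset.Icc 1 ⌊√x / k⌋₊, (√x / k / j - j / (√x / k))) := by
  calc _ = ∑ a ∈ Finset.Icc 1 ⌊√x⌋₊, ∑ k ∈ D.divisors,
        if k ∣ a then moebiusSum (divisorWeight c) k * (x / a - a) else 0 := by
        refine Finset.sum_congr rfl fun a ha => ?_
        rw [← sum_divisors_moebiusSum (divisorWeight c) (Nat.gcd_pos_of_pos_right a hD),
          Finset.sum_mul, ← Finset.sum_filter]
        refine Finset.sum_congr ?_ fun _ _ => rfl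
        ext k
        simp only [Nat.mem_divisors, Finset.mem_filter, Nat.dvd_gcd_iff]
        have := (Nat.gcd_pos_of_pos_right a hD).ne'
        have := hD.ne'
        tauto
    _ = _ := by
        rw [Finset.sum_comm]
        refine Finset.sum_congr rfl fun k hk => ?_
        have hk0 := Nat.pos_of_mem_divisors hk
        have hkpos : (0 : ℝ) < k := by exact_mod_cast hk0
        rw [← Finset.sum_filter,
          sum_filter_dvd_Icc (fun a => moebiusSum (divisorWeight c) k * (x / a - a)) hk0,
          Nat.floor_div_natCast, Finset.mul_sum, Finset.mul_sum]
        refine Finset.sum_congr rfl fun j hj => ?_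
        have hjpos : (0 : ℝ) < j := by exact_mod_cast (Finset.mem_Icc.1 hj).1
        have hs : 0 < √x := Real.sqrt_pos.2 hx
        congr 1
        push_cast
        field_simp
        rw [Real.sq_sqrt hx.le]

lemma abs_sum_divisorWeight_gcd_sub_le {D c : ℕ} (hD : 0 < D) (hc : 0 < c) {x : ℝ} (hx : 0 < x) :
    |(2 / D) * ∑ a ∈ Finset.Icc 1 ⌊√x⌋₊, divisorWeight c (a.gcd D) * (x / a - a) -
      x * (logCoeff D c * Real.log x + linCoeff D c)| ≤
      6 * (c : ℝ) ^ 2 * D.divisors.card * √x := by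
  have hD1 : (1 : ℝ) ≤ D := by exact_mod_cast hD
  have hs : 0 < √x := Real.sqrt_pos.2 hx
  have hmain : x * (logCoeff D c * Real.log x + linCoeff D c) =
      (2 / D) * ∑ k ∈ D.divisors, moebiusSum (divisorWeight c) k *
        (√x * (√x / k * (Real.log (√x / k) + Real.eulerMascheroniConstant - 1 / 2))) := by
    rw [logCoeff, linCoeff, Finset.mul_sum, Finset.mul_sum, Finset.mul_sum, Finset.sum_mul,
      ← Finset.sum_add_distrib, Finset.mul_sum]
    refine Finset.sum_congr rfl fun k hk => ?_
    have hkpos : (0 : ℝ) < k := by exact_mod_cast Nat.pos_of_mem_divisors hk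
    rw [Real.log_div hs.ne' hkpos.ne', Real.log_sqrt hx.le]
    have hxs : √x * √x = x := Real.mul_self_sqrt hx.le
    field_simp
    rw [Real.sq_sqrt hx.le]
    ring
  rw [hmain, sum_divisorWeight_gcd_eq hD c hx, ← mul_sub, ← Finset.sum_sub_distrib, abs_mul,
    abs_of_nonneg (by positivity)]
  calc _ ≤ (2 / (D : ℝ)) * ∑ k ∈ D.divisors, (c : ℝ) ^ 2 * (√x * 3) := by
        gcongr
        refine (Finset.abs_sum_le_sum_abs _ _).trans (Finset.sum_le_sum fun k hk => ?_)
        have hkpos : (0 : ℝ) < k := by exact_mod_cast Nat.pos_of_mem_divisors hk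
        rw [← mul_sub, ← mul_sub, abs_mul, abs_mul, abs_of_pos hs]
        gcongr
        · exact abs_moebiusSum_divisorWeight_le hc k
        · exact abs_sum_div_sub_div_sub_le (by positivity)
    _ = (2 / (D : ℝ)) * (3 * (c : ℝ) ^ 2 * D.divisors.card * √x) := by
        rw [Finset.sum_const, nsmul_eq_mul]; ring
    _ ≤ 2 * (3 * (c : ℝ) ^ 2 * D.divisors.card * √x) := by
        gcongr
        exact div_le_self (by norm_num) hD1
    _ = _ := by ring

lemma abs_divisorSum_sub_le {D c : ℕ} (hD : 0 < D) (hc : 0 < c) {x : ℝ} (hx : 1 ≤ x) :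
    |divisorSum D c x - x * (logCoeff D c * Real.log x + linCoeff D c)| ≤
      18 * (c : ℝ) ^ 2 * D.divisors.card * √x := by
  have hx0 : 0 < x := by linarith
  have h1 := two_mul_smallDivisorCount_le hD c x
  have h2 := divisorSum_le hD c x
  have h3 := abs_smallDivisorCount_sub_le hD c hx0.le
  have h4 := abs_sum_divisorWeight_gcd_sub_le hD hc hx0
  have hc1 : (1 : ℝ) ≤ c := by exact_mod_cast hc
  have hd1 : (1 : ℝ) ≤ D.divisors.card := by
    exact_mod_cast Finset.card_pos.2 ⟨1, Nat.one_mem_divisors.2 hD.ne'⟩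
  have hs : 0 ≤ √x := Real.sqrt_nonneg x
  have hsqrt : √(x + c) ≤ 2 * c * √x := by
    rw [Real.sqrt_le_left (by positivity), mul_pow, Real.sq_sqrt hx0.le]
    nlinarith [mul_le_mul hc1 hx (by norm_num) (by positivity)]
  have h5 : 2 * ((c + 1) * √(x + c)) ≤ 8 * ((c : ℝ) ^ 2 * √x) := by
    calc 2 * ((c + 1) * √(x + c)) ≤ 2 * ((c + c) * (2 * c * √x)) := by gcongr
      _ = _ := by ring
  have hcd : (1 : ℝ) ≤ (c : ℝ) ^ 2 := one_le_pow₀ hc1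
  have h6 : (c : ℝ) ^ 2 * √x ≤ (c : ℝ) ^ 2 * D.divisors.card * √x := by
    rw [mul_right_comm]
    exact le_mul_of_one_le_right (by positivity) hd1
  have h7 : √x ≤ (c : ℝ) ^ 2 * √x := le_mul_of_one_le_left hs hcd
  set S := ∑ a ∈ Finset.Icc 1 ⌊√x⌋₊, divisorWeight c (a.gcd D) * (x / a - a)
  have h8 : (2 / (D : ℝ)) * S = 2 * ((1 / D) * S) := by ring
  rw [h8] at h4
  rw [abs_le] at h3 h4 ⊢
  constructor <;> linarith [h3.1, h3.2, h4.1, h4.2]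

end Progression

section Bounds

lemma abs_moebiusSum_le_card_mul {G : ℕ → ℝ} {n : ℕ} {K : ℝ} (h : ∀ e ∈ n.divisors, |G e| ≤ K) :
    |moebiusSum G n| ≤ n.divisors.card * K := by
  refine (abs_moebiusSum_le G n).trans ?_
  rw [← nsmul_eq_mul]
  exact Finset.sum_le_card_nsmul _ _ _ h

lemma abs_logCoeff_le {D c : ℕ} (hc : 0 < c) :
    |logCoeff D c| ≤ (c : ℝ) ^ 2 * D.divisors.card / D := by
  rw [logCoeff, abs_mul, abs_of_nonneg (by positivity), one_div, inv_mul_eq_div]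
  gcongr
  refine (Finset.abs_sum_le_sum_abs _ _).trans ?_
  rw [mul_comm, ← nsmul_eq_mul]
  refine Finset.sum_le_card_nsmul _ _ _ fun k hk => ?_
  have hk1 : (1 : ℝ) ≤ k := by exact_mod_cast Nat.pos_of_mem_divisors hk
  rw [abs_div, Nat.abs_cast]
  exact (div_le_self (abs_nonneg _) hk1).trans (abs_moebiusSum_divisorWeight_le hc k)

lemma abs_linCoeff_le {D c : ℕ} (hc : 0 < c) :
    |linCoeff D c| ≤ 2 * ((c : ℝ) ^ 2 * D.divisors.card * (1 + Real.log D) / D) := by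
  rw [linCoeff, abs_mul, abs_of_nonneg (by positivity), div_mul_eq_mul_div, mul_div_assoc]
  gcongr
  refine (Finset.abs_sum_le_sum_abs _ _).trans ?_
  rw [mul_comm ((c : ℝ) ^ 2), mul_assoc, ← nsmul_eq_mul]
  refine Finset.sum_le_card_nsmul _ _ _ fun k hk => ?_
  have hk1 : (1 : ℝ) ≤ k := by exact_mod_cast Nat.pos_of_mem_divisors hk
  have hkD : (k : ℝ) ≤ D := by exact_mod_cast Nat.divisor_le hk
  rw [abs_mul, abs_div, Nat.abs_cast]
  gcongr
  · exact (div_le_self (abs_nonneg _) hk1).trans (abs_moebiusSum_divisorWeight_le hc k)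
  · have h1 := Real.one_half_lt_eulerMascheroniConstant
    have h2 := Real.eulerMascheroniConstant_lt_two_thirds
    have h3 := Real.log_nonneg hk1
    have h4 := Real.log_le_log (by linarith) hkD
    rw [abs_le]
    constructor <;> linarith

lemma one_add_log_le_mul_rpow {η : ℝ} (hη : 0 < η) {x : ℝ} (hx : 1 ≤ x) :
    1 + Real.log x ≤ (1 + η⁻¹) * x ^ η := by
  have h1 := Real.log_le_rpow_div (by linarith : 0 ≤ x) hη
  have h2 := Real.one_le_rpow hx hη.le
  rw [div_eq_inv_mul] at h1
  linarith

/-- The contribution of `D` to the summatory function. -/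
noncomputable def levelSum (D : ℕ) (x : ℝ) : ℝ :=
  moebiusSum (fun e => divisorSum D (abelianCount e) x) D

/-- The contribution of `D` to the coefficient of `x * log x`. -/
noncomputable def levelLogCoeff (D : ℕ) : ℝ :=
  moebiusSum (fun e => logCoeff D (abelianCount e)) D

/-- The contribution of `D` to the coefficient of `x`. -/
noncomputable def levelLinCoeff (D : ℕ) : ℝ :=
  moebiusSum (fun e => linCoeff D (abelianCount e)) D

lemma levelSum_sub_eq (D : ℕ) (x : ℝ) :
    levelSum D x - x * (levelLogCoeff D * Real.log x + levelLinCoeff D) =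
      moebiusSum (fun e => divisorSum D (abelianCount e) x -
        x * (logCoeff D (abelianCount e) * Real.log x + linCoeff D (abelianCount e))) D := by
  simp only [levelSum, levelLogCoeff, levelLinCoeff, moebiusSum]
  rw [Finset.sum_mul, ← Finset.sum_add_distrib, Finset.mul_sum, ← Finset.sum_sub_distrib]
  exact Finset.sum_congr rfl fun e _ => by ring

lemma exists_uniform_bounds {η : ℝ} (hη : 0 < η) :
    ∃ C : ℝ, 1 ≤ C ∧ (∀ n : ℕ, 0 < n → (n.divisors.card : ℝ) ≤ C * (n : ℝ) ^ η) ∧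
      (∀ D : ℕ, ∀ e ∈ D.divisors, (abelianCount e : ℝ) ≤ C * (D : ℝ) ^ η) ∧
      ∀ x : ℝ, 1 ≤ x → 1 + Real.log x ≤ C * x ^ η := by
  obtain ⟨C₁, h₁, hd⟩ := exists_card_divisors_le hη
  obtain ⟨C₂, h₂, ha⟩ := exists_abelianCount_le hη
  have h₃ : 0 < η⁻¹ := inv_pos.2 hη
  refine ⟨C₁ + C₂ + (1 + η⁻¹), by linarith, fun n hn => (hd n hn).trans ?_,
    fun D e he => (ha e (Nat.pos_of_mem_divisors he)).trans ?_,
    fun x hx => (one_add_log_le_mul_rpow hη hx).trans ?_⟩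
  · gcongr
    linarith
  · have heD : (e : ℝ) ≤ D := by exact_mod_cast Nat.divisor_le he
    gcongr
    linarith
  · exact mul_le_mul_of_nonneg_right (by linarith) (by positivity)

lemma rpow_pow_eq {D η : ℝ} (hD : 0 ≤ D) (k : ℕ) : (D ^ η) ^ k = D ^ (k * η) := by
  rw [← Real.rpow_natCast, ← Real.rpow_mul hD, mul_comm]

lemma exists_levelCoeff_le {η : ℝ} (hη : 0 < η) :
    ∃ C : ℝ, 0 ≤ C ∧ ∀ D : ℕ, 0 < D →
      |levelLogCoeff D| ≤ C * (D : ℝ) ^ (-1 + 5 * η) ∧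
      |levelLinCoeff D| ≤ C * (D : ℝ) ^ (-1 + 5 * η) := by
  obtain ⟨C, hC, hd, ha, hl⟩ := exists_uniform_bounds hη
  refine ⟨2 * C ^ 5, by positivity, fun D hD => ?_⟩
  have hD1 : (1 : ℝ) ≤ D := by exact_mod_cast hD
  have hDpos : (0 : ℝ) < D := by linarith
  have hlog := Real.log_nonneg hD1
  have hP : (D : ℝ) ^ (-1 + 5 * η) = ((D : ℝ) ^ η) ^ 5 / D := by
    rw [rpow_pow_eq hDpos.le, Real.rpow_add hDpos, Real.rpow_neg_one]
    push_cast
    ring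
  have hfin : (D.divisors.card : ℝ) *
      (2 * ((C * (D : ℝ) ^ η) ^ 2 * D.divisors.card * (1 + Real.log D) / D)) ≤
      2 * C ^ 5 * (D : ℝ) ^ (-1 + 5 * η) := by
    calc _ ≤ (C * (D : ℝ) ^ η) * (2 * ((C * (D : ℝ) ^ η) ^ 2 * (C * (D : ℝ) ^ η) *
          (C * (D : ℝ) ^ η) / D)) := by
          gcongr
          · exact hd D hD
          · exact hd D hD
          · exact hl D hD1
      _ = _ := by rw [hP]; ring
  constructor
  · refine (abs_moebiusSum_le_card_mul fun e he => ?_).trans hfin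
    refine (abs_logCoeff_le (abelianCount_pos e)).trans ?_
    calc _ ≤ (C * (D : ℝ) ^ η) ^ 2 * D.divisors.card / D := by
          gcongr
          exact ha D e he
      _ ≤ 2 * ((C * (D : ℝ) ^ η) ^ 2 * D.divisors.card * 1 / D) := by
          rw [mul_one]
          exact le_mul_of_one_le_left (by positivity) (by norm_num)
      _ ≤ _ := by
          gcongr
          linarith
  · refine (abs_moebiusSum_le_card_mul fun e he => ?_).trans hfin
    refine (abs_linCoeff_le (abelianCount_pos e)).trans ?_
    gcongr
    exact ha D e he

lemma exists_levelSum_sub_le_sqrt {η : ℝ} (hη : 0 < η) :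
    ∃ C : ℝ, 0 ≤ C ∧ ∀ D : ℕ, 0 < D → ∀ x : ℝ, 1 ≤ x →
      |levelSum D x - x * (levelLogCoeff D * Real.log x + levelLinCoeff D)| ≤
        C * x ^ (1 / 2 : ℝ) * (D : ℝ) ^ (5 * η) := by
  obtain ⟨C, hC, hd, ha, -⟩ := exists_uniform_bounds hη
  refine ⟨18 * C ^ 4, by positivity, fun D hD x hx => ?_⟩
  have hD1 : (1 : ℝ) ≤ D := by exact_mod_cast hD
  rw [levelSum_sub_eq]
  calc _ ≤ D.divisors.card * (18 * (C * (D : ℝ) ^ η) ^ 2 * D.divisors.card * √x) := by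
        refine abs_moebiusSum_le_card_mul fun e he => ?_
        refine (abs_divisorSum_sub_le hD (abelianCount_pos e) hx).trans ?_
        gcongr
        exact ha D e he
    _ ≤ (C * (D : ℝ) ^ η) * (18 * (C * (D : ℝ) ^ η) ^ 2 * (C * (D : ℝ) ^ η) * √x) := by
        gcongr
        · exact hd D hD
        · exact hd D hD
    _ = 18 * C ^ 4 * x ^ (1 / 2 : ℝ) * (D : ℝ) ^ (4 * η) := by
        rw [← Real.sqrt_eq_rpow, show (4 : ℝ) = ((4 : ℕ) : ℝ) by norm_num,
          ← rpow_pow_eq (by linarith)]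
        ring
    _ ≤ _ := by
        gcongr
        norm_num

lemma divisorSum_eq_zero {D : ℕ} {x : ℝ} (hx : 0 ≤ x) (h : x < D) (c : ℕ) :
    divisorSum D c x = 0 := by
  rw [divisorSum, Nat.floor_eq_zero.2 ((div_lt_one (hx.trans_lt h)).2 h)]
  simp

lemma exists_levelSum_le {η : ℝ} (hη : 0 < η) (hη1 : η ≤ 1) :
    ∃ C : ℝ, 0 ≤ C ∧ ∀ D : ℕ, 0 < D → ∀ x : ℝ, 1 ≤ x →
      |levelSum D x| ≤ C * x ^ (1 + η) * (D : ℝ) ^ (-1 + η) := by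
  obtain ⟨C, hC, hd, ha, -⟩ := exists_uniform_bounds hη
  refine ⟨2 * C ^ 3, by positivity, fun D hD x hx => ?_⟩
  have hD1 : (1 : ℝ) ≤ D := by exact_mod_cast hD
  have hx0 : 0 < x := by linarith
  have hsum : ∀ e ∈ D.divisors, |divisorSum D (abelianCount e) x| ≤ x / D * (2 * C ^ 2 * x ^ η) := by
    intro e he
    rcases lt_or_ge x D with hlt | hge
    · rw [divisorSum_eq_zero hx0.le hlt, abs_zero]
      positivity
    rw [divisorSum, abs_of_nonneg (by positivity)]
    have hae : (abelianCount e : ℝ) ≤ C * x := by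
      refine (ha D e he).trans ?_
      gcongr
      calc (D : ℝ) ^ η ≤ (D : ℝ) ^ (1 : ℝ) := Real.rpow_le_rpow_of_exponent_le hD1 hη1
        _ ≤ x := by rwa [Real.rpow_one]
    have hterm : ∀ m ∈ Finset.Icc 1 ⌊x / D⌋₊,
        ((D * m + abelianCount e).divisors.card : ℝ) ≤ 2 * C ^ 2 * x ^ η := by
      intro m hm
      have hle : ((D * m + abelianCount e : ℕ) : ℝ) ≤ 2 * C * x := by
        push_cast
        nlinarith [mul_le_of_mem_Icc_floor_div hD hm]
      calc _ ≤ C * ((D * m + abelianCount e : ℕ) : ℝ) ^ η :=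
            hd _ (by have := abelianCount_pos e; omega)
        _ ≤ C * (2 * C * x) ^ η := by gcongr
        _ = C * ((2 * C) ^ η * x ^ η) := by rw [Real.mul_rpow (by positivity) hx0.le]
        _ ≤ C * ((2 * C) ^ (1 : ℝ) * x ^ η) := by
            gcongr
            linarith
        _ = _ := by rw [Real.rpow_one]; ring
    refine (Finset.sum_le_card_nsmul _ _ _ hterm).trans ?_
    rw [nsmul_eq_mul, Nat.card_Icc, Nat.add_sub_cancel]
    gcongr
    exact Nat.floor_le (by positivity)
  calc _ ≤ D.divisors.card * (x / D * (2 * C ^ 2 * x ^ η)) := abs_moebiusSum_le_card_mul hsum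
    _ ≤ (C * (D : ℝ) ^ η) * (x / D * (2 * C ^ 2 * x ^ η)) := by
        gcongr
        exact hd D hD
    _ = _ := by
        rw [Real.rpow_add hx0, Real.rpow_add (by linarith), Real.rpow_one, Real.rpow_neg_one]
        field_simp

lemma exists_levelSum_sub_le_div {η : ℝ} (hη : 0 < η) (hη1 : η ≤ 1) :
    ∃ C : ℝ, 0 ≤ C ∧ ∀ D : ℕ, 0 < D → ∀ x : ℝ, 1 ≤ x →
      |levelSum D x - x * (levelLogCoeff D * Real.log x + levelLinCoeff D)| ≤
        C * x ^ (1 + η) * (D : ℝ) ^ (-1 + 5 * η) := by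
  obtain ⟨C₁, hC₁, h₁⟩ := exists_levelSum_le hη hη1
  obtain ⟨C₂, hC₂, h₂⟩ := exists_levelCoeff_le hη
  obtain ⟨C₃, hC₃, -, -, h₃⟩ := exists_uniform_bounds hη
  refine ⟨C₁ + C₂ * C₃, by positivity, fun D hD x hx => ?_⟩
  have hD1 : (1 : ℝ) ≤ D := by exact_mod_cast hD
  have hx0 : 0 < x := by linarith
  have hlog := Real.log_nonneg hx
  have hA := h₁ D hD x hx
  have hB : |x * (levelLogCoeff D * Real.log x + levelLinCoeff D)| ≤
      C₂ * C₃ * x ^ (1 + η) * (D : ℝ) ^ (-1 + 5 * η) := by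
    rw [abs_mul, abs_of_pos hx0]
    calc _ ≤ x * (C₂ * (D : ℝ) ^ (-1 + 5 * η) * Real.log x + C₂ * (D : ℝ) ^ (-1 + 5 * η)) := by
          gcongr
          refine (abs_add_le _ _).trans ?_
          rw [abs_mul, abs_of_nonneg hlog]
          gcongr
          · exact (h₂ D hD).1
          · exact (h₂ D hD).2
      _ = x * (C₂ * (D : ℝ) ^ (-1 + 5 * η)) * (1 + Real.log x) := by ring
      _ ≤ x * (C₂ * (D : ℝ) ^ (-1 + 5 * η)) * (C₃ * x ^ η) := by
          gcongr
          exact h₃ x hx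
      _ = _ := by rw [Real.rpow_add hx0, Real.rpow_one]; ring
  have hA' : C₁ * x ^ (1 + η) * (D : ℝ) ^ (-1 + η) ≤
      C₁ * x ^ (1 + η) * (D : ℝ) ^ (-1 + 5 * η) := by
    gcongr
    linarith
  refine (abs_sub _ _).trans ?_
  rw [add_mul, add_mul]
  exact add_le_add (hA.trans hA') hB

lemma exists_levelSum_sub_le {η : ℝ} (hη : 0 < η) (hη1 : η ≤ 1 / 12) :
    ∃ C : ℝ, 0 ≤ C ∧ ∀ D : ℕ, 0 < D → ∀ x : ℝ, 1 ≤ x →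
      |levelSum D x - x * (levelLogCoeff D * Real.log x + levelLinCoeff D)| ≤
        C * x ^ (3 / 4 + 4 * η) * (D : ℝ) ^ (-(1 / 2 + η)) := by
  obtain ⟨C₁, hC₁, h₁⟩ := exists_levelSum_sub_le_sqrt hη
  obtain ⟨C₂, hC₂, h₂⟩ := exists_levelSum_sub_le_div hη (by linarith)
  refine ⟨C₁ + C₂, by positivity, fun D hD x hx => ?_⟩
  have hDpos : (0 : ℝ) < D := by exact_mod_cast hD
  have hx0 : 0 < x := by linarith
  have hroot : ∀ s : ℝ, (x ^ (1 / 2 : ℝ)) ^ s = x ^ (s / 2) := fun s => by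
    rw [← Real.rpow_mul hx0.le]
    congr 1
    ring
  rcases le_total (D : ℝ) (x ^ (1 / 2 : ℝ)) with hle | hle
  · calc _ ≤ _ := h₁ D hD x hx
      _ = C₁ * x ^ (1 / 2 : ℝ) * ((D : ℝ) ^ (1 / 2 + 6 * η) * (D : ℝ) ^ (-(1 / 2 + η))) := by
          rw [← Real.rpow_add hDpos]
          congr 2
          ring
      _ ≤ C₁ * x ^ (1 / 2 : ℝ) *
          ((x ^ (1 / 2 : ℝ)) ^ (1 / 2 + 6 * η) * (D : ℝ) ^ (-(1 / 2 + η))) := by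
          gcongr
      _ = C₁ * x ^ (3 / 4 + 3 * η) * (D : ℝ) ^ (-(1 / 2 + η)) := by
          rw [hroot, show 3 / 4 + 3 * η = 1 / 2 + (1 / 2 + 6 * η) / 2 by ring, Real.rpow_add hx0]
          ring
      _ ≤ _ := by
          gcongr
          · linarith
          · norm_num
  · calc _ ≤ _ := h₂ D hD x hx
      _ = C₂ * x ^ (1 + η) * ((D : ℝ) ^ (-1 / 2 + 6 * η) * (D : ℝ) ^ (-(1 / 2 + η))) := by
          rw [← Real.rpow_add hDpos]
          congr 2
          ring
      _ ≤ C₂ * x ^ (1 + η) *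
          ((x ^ (1 / 2 : ℝ)) ^ (-1 / 2 + 6 * η) * (D : ℝ) ^ (-(1 / 2 + η))) := by
          have := Real.rpow_le_rpow_of_nonpos (by positivity) hle
            (by linarith : -1 / 2 + 6 * η ≤ 0)
          gcongr
      _ = C₂ * x ^ (3 / 4 + 4 * η) * (D : ℝ) ^ (-(1 / 2 + η)) := by
          have : x ^ (3 / 4 + 4 * η) = x ^ (1 + η) * x ^ ((-1 / 2 + 6 * η) / 2) := by
            rw [← Real.rpow_add hx0]
            congr 1
            ring
          rw [hroot, this]
          ring
      _ ≤ _ := by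
          gcongr
          linarith

end Bounds

section Asymptotic

/-- The summatory function of `d (n + a n)`. -/
noncomputable def shiftSum (x : ℝ) : ℝ :=
  ∑ n ∈ Finset.Icc 1 ⌊x⌋₊, ((n + abelianCount n).divisors.card : ℝ)

lemma moebiusSum_abelianCount_of_notMem (G : ℕ → ℝ) {D : ℕ}
    (h : D ∉ {n : ℕ | 0 < n ∧ Squarefull n}) :
    moebiusSum (fun e => G (abelianCount e)) D = 0 := by
  rcases Nat.eq_zero_or_pos D with rfl | hD
  · simp [moebiusSum]
  · exact moebiusSum_abelianCount_eq_zero G fun hs => h ⟨hD, hs⟩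

lemma abs_le_mul_indicator {f g : ℕ → ℝ} {s : Set ℕ} {K : ℝ} {D : ℕ} (h0 : D ∉ s → f D = 0)
    (h : D ∈ s → |f D| ≤ K * g D) : |f D| ≤ K * s.indicator g D := by
  by_cases hD : D ∈ s
  · rw [Set.indicator_of_mem hD]
    exact h hD
  · rw [Set.indicator_of_notMem hD, h0 hD]
    simp

lemma summable_levelCoeff : Summable levelLogCoeff ∧ Summable levelLinCoeff := by
  obtain ⟨C, -, hC⟩ := exists_levelCoeff_le (η := 1 / 20) (by norm_num)
  have hs := (summable_squarefull_rpow (σ := 3 / 4) (by norm_num)).mul_left C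
  have he : (-1 + 5 * (1 / 20) : ℝ) = -(3 / 4) := by norm_num
  rw [he] at hC
  exact ⟨hs.of_norm_bounded fun D => abs_le_mul_indicator
      (moebiusSum_abelianCount_of_notMem fun c => logCoeff D c) fun hD => (hC D hD.1).1,
    hs.of_norm_bounded fun D => abs_le_mul_indicator
      (moebiusSum_abelianCount_of_notMem fun c => linCoeff D c) fun hD => (hC D hD.1).2⟩

lemma shiftSum_eq_sum_levelSum (x : ℝ) :
    shiftSum x = ∑ D ∈ Finset.Icc 1 ⌊x⌋₊, levelSum D x := by
  have h : shiftSum x = ∑ n ∈ Finset.Icc 1 ⌊x⌋₊, ∑ D ∈ n.divisors,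
      moebiusSum (fun e => ((n + abelianCount e).divisors.card : ℝ)) D :=
    Finset.sum_congr rfl fun n hn =>
      (sum_divisors_moebiusSum (fun e => ((n + abelianCount e).divisors.card : ℝ))
        (Finset.mem_Icc.1 hn).1).symm
  rw [h, sum_Icc_sum_divisors fun n D =>
    moebiusSum (fun e => ((n + abelianCount e).divisors.card : ℝ)) D]
  refine Finset.sum_congr rfl fun D _ => ?_
  simp only [levelSum, moebiusSum, divisorSum, Finset.mul_sum]
  rw [Finset.sum_comm, Nat.floor_div_natCast]

lemma hasSum_levelSum {x : ℝ} (hx : 0 ≤ x) : HasSum (fun D => levelSum D x) (shiftSum x) := by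
  rw [shiftSum_eq_sum_levelSum]
  refine hasSum_sum_of_ne_finset_zero fun D hD => ?_
  rcases Nat.eq_zero_or_pos D with rfl | hD0
  · simp [levelSum, moebiusSum]
  · have hlt : x < D := by
      rw [← Nat.floor_lt hx]
      by_contra! h
      exact hD (Finset.mem_Icc.2 ⟨hD0, h⟩)
    simp [levelSum, moebiusSum, divisorSum_eq_zero hx hlt]

lemma exists_shiftSum_sub_le {ε : ℝ} (hε : 0 < ε) :
    ∃ C : ℝ, ∀ x : ℝ, 1 ≤ x →
      |shiftSum x - x * ((∑' D, levelLogCoeff D) * Real.log x + ∑' D, levelLinCoeff D)| ≤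
        C * x ^ (3 / 4 + ε) := by
  set η := min (ε / 4) (1 / 12) with hη
  have hη0 : 0 < η := lt_min (by linarith) (by norm_num)
  have hηε : 4 * η ≤ ε := by linarith [min_le_left (ε / 4) (1 / 12 : ℝ)]
  obtain ⟨C, hC0, hC⟩ := exists_levelSum_sub_le hη0 (min_le_right _ _)
  have hs := summable_squarefull_rpow (σ := 1 / 2 + η) (by linarith)
  have hT := hs.hasSum
  set T := ∑' n, {n : ℕ | 0 < n ∧ Squarefull n}.indicator
    (fun n => (n : ℝ) ^ (-(1 / 2 + η))) n
  have hT0 : 0 ≤ T := hT.nonneg fun n => Set.indicator_nonneg (fun n _ => by positivity) n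
  refine ⟨C * T, fun x hx => ?_⟩
  have hmain := (hasSum_levelSum (by linarith : 0 ≤ x)).sub
    (((summable_levelCoeff.1.hasSum.mul_right (Real.log x)).add
      summable_levelCoeff.2.hasSum).mul_left x)
  rw [← hmain.tsum_eq, ← Real.norm_eq_abs]
  calc _ ≤ C * x ^ (3 / 4 + 4 * η) * T := by
        refine tsum_of_norm_bounded (hT.mul_left _) fun D => abs_le_mul_indicator
          (f := fun D => levelSum D x - x * (levelLogCoeff D * Real.log x + levelLinCoeff D))
          (fun hD => ?_) fun hD => hC D hD.1 x hx
        simp only [levelSum_sub_eq]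
        exact moebiusSum_abelianCount_of_notMem (fun c => divisorSum D c x -
          x * (logCoeff D c * Real.log x + linCoeff D c)) hD
    _ = C * T * x ^ (3 / 4 + 4 * η) := by ring
    _ ≤ _ := by gcongr

end Asymptotic

section LeadingCoefficient

lemma exists_sq_dvd_of_not_squarefree {n : ℕ} (hn : 0 < n) (h : ¬ Squarefree n) :
    ∃ d ∈ Finset.Icc 2 n.sqrt, d ^ 2 ∣ n := by
  rw [Nat.squarefree_iff_prime_squarefree] at h
  push Not at h
  obtain ⟨p, hp, hpn⟩ := h
  exact ⟨p, Finset.mem_Icc.2 ⟨hp.two_le, Nat.le_sqrt.2 (Nat.le_of_dvd hn hpn)⟩, by rwa [pow_two]⟩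

lemma sum_Icc_inv_sq_le (n : ℕ) : ∑ d ∈ Finset.Icc 2 n, 1 / (d : ℝ) ^ 2 ≤ 3 / 4 := by
  have h : ∀ n : ℕ, 2 ≤ n →
      ∑ d ∈ Finset.Icc 2 n, 1 / (d : ℝ) ^ 2 ≤ 3 / 4 - 1 / (n : ℝ) := fun n hn => by
    induction n, hn using Nat.le_induction with
    | base => norm_num
    | succ n hn ih =>
      have hn0 : (0 : ℝ) < n := by exact_mod_cast (by omega : 0 < n)
      have hstep : 1 / ((n : ℝ) + 1) ^ 2 ≤ 1 / n - 1 / (n + 1) := by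
        rw [div_sub_div _ _ hn0.ne' (by positivity), div_le_div_iff₀ (by positivity) (by positivity)]
        nlinarith
      rw [Finset.sum_Icc_succ_top (by omega)]
      push_cast
      linarith
  rcases lt_or_ge n 2 with hn | hn
  · rw [Finset.Icc_eq_empty (by omega)]
    norm_num
  · exact (h n hn).trans (sub_le_self _ (by positivity))

lemma le_card_squarefree_dvd_succ {k : ℕ} (hk : 0 < k) (N : ℕ) :
    (N : ℝ) / (4 * k) - (1 + N.sqrt) ≤
      ((Finset.Icc 1 N).filter fun n => Squarefree n ∧ k ∣ n + 1).card := by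
  have hk0 : (0 : ℝ) < k := by exact_mod_cast hk
  have hall : (N : ℝ) / k - 1 ≤ ((Finset.Icc 1 N).filter fun n => k ∣ n + 1).card := by
    have := abs_card_Ioc_dvd_sub_le (D := 1) hk (Nat.zero_le N) 1
    simp only [Nat.gcd_one_right, divisorWeight, one_dvd, if_true, one_mul] at this
    have := (abs_le.1 this).1
    rw [← Finset.Icc_add_one_left_eq_Ioc] at this
    push_cast at this
    simp only [sub_zero] at this
    field_simp at this ⊢
    linarith
  have hsq : ∀ d ∈ Finset.Icc 2 N.sqrt,
      (((Finset.Icc 1 N).filter fun n => d ^ 2 ∣ n ∧ k ∣ n + 1).card : ℝ) ≤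
        N / k * (1 / (d : ℝ) ^ 2) + 1 := by
    intro d hd
    have hd0 : 0 < d ^ 2 := by have := (Finset.mem_Icc.1 hd).1; positivity
    have hcard : ((Finset.Icc 1 N).filter fun n => d ^ 2 ∣ n ∧ k ∣ n + 1).card =
        ((Finset.Ioc 0 (N / d ^ 2)).filter fun m => k ∣ d ^ 2 * m + 1).card := by
      rw [← Finset.filter_filter, Finset.card_filter, sum_filter_dvd_Icc _ hd0,
        Finset.card_filter]
      rfl
    have := (abs_le.1 (abs_card_Ioc_dvd_sub_le (D := d ^ 2) hk (Nat.zero_le (N / d ^ 2)) 1)).2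
    rw [hcard]
    have hw : divisorWeight 1 (k.gcd (d ^ 2)) ≤ 1 := by
      rw [divisorWeight]
      split_ifs with h
      · rw [Nat.dvd_one.1 h, Nat.cast_one]
      · exact zero_le_one
    have hdiv : ((N / d ^ 2 : ℕ) : ℝ) ≤ N / (d : ℝ) ^ 2 := by
      exact_mod_cast Nat.cast_div_le (α := ℝ) (m := N) (n := d ^ 2)
    have : (((N / d ^ 2 : ℕ) : ℝ) - (0 : ℕ)) * (divisorWeight 1 (k.gcd (d ^ 2)) / k) ≤
        N / (d : ℝ) ^ 2 * (1 / k) := by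
      rw [Nat.cast_zero, sub_zero]
      have := divisorWeight_nonneg 1 (k.gcd (d ^ 2))
      gcongr
    calc _ ≤ N / (d : ℝ) ^ 2 * (1 / k) + 1 := by linarith
      _ = _ := by ring
  have hcover : (Finset.Icc 1 N).filter (fun n => k ∣ n + 1) ⊆
      ((Finset.Icc 1 N).filter fun n => Squarefree n ∧ k ∣ n + 1) ∪
        (Finset.Icc 2 N.sqrt).biUnion fun d =>
          (Finset.Icc 1 N).filter fun n => d ^ 2 ∣ n ∧ k ∣ n + 1 := by
    intro n hn
    obtain ⟨hn, hkn⟩ := Finset.mem_filter.1 hn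
    obtain ⟨hn1, hnN⟩ := Finset.mem_Icc.1 hn
    rw [Finset.mem_union, Finset.mem_biUnion]
    by_cases h : Squarefree n
    · exact Or.inl (Finset.mem_filter.2 ⟨hn, h, hkn⟩)
    · obtain ⟨d, hd, hdn⟩ := exists_sq_dvd_of_not_squarefree hn1 h
      exact Or.inr ⟨d, Finset.Icc_subset_Icc_right (Nat.sqrt_le_sqrt hnN) hd,
        Finset.mem_filter.2 ⟨hn, hdn, hkn⟩⟩
  have hle : (((Finset.Icc 1 N).filter fun n => k ∣ n + 1).card : ℝ) ≤
      ((Finset.Icc 1 N).filter fun n => Squarefree n ∧ k ∣ n + 1).card +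
        ∑ d ∈ Finset.Icc 2 N.sqrt,
          (((Finset.Icc 1 N).filter fun n => d ^ 2 ∣ n ∧ k ∣ n + 1).card : ℝ) := by
    exact_mod_cast (Finset.card_le_card hcover).trans
      ((Finset.card_union_le _ _).trans (Nat.add_le_add_left Finset.card_biUnion_le _))
  have hsum := Finset.sum_le_sum hsq
  rw [Finset.sum_add_distrib, ← Finset.mul_sum, Finset.sum_const, nsmul_one] at hsum
  have hcardIcc : ((Finset.Icc 2 N.sqrt).card : ℝ) ≤ N.sqrt := by
    rw [Nat.card_Icc]
    exact_mod_cast (by omega : N.sqrt + 1 - 2 ≤ N.sqrt)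
  have hinv : (N : ℝ) / k * ∑ d ∈ Finset.Icc 2 N.sqrt, 1 / (d : ℝ) ^ 2 ≤ N / k * (3 / 4) := by
    gcongr
    exact sum_Icc_inv_sq_le _
  have hsplit : (N : ℝ) / (4 * k) = N / k - N / k * (3 / 4) := by
    field_simp
    ring
  linarith

lemma le_shiftSum (K N : ℕ) :
    (N : ℝ) / 4 * harmonic K - K * (1 + N.sqrt) ≤ shiftSum N := by
  have hcast : (harmonic K : ℝ) = ∑ k ∈ Finset.Icc 1 K, ((k : ℝ))⁻¹ := by
    rw [harmonic_eq_sum_Icc]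
    push_cast
    rfl
  calc _ = ∑ k ∈ Finset.Icc 1 K, ((N : ℝ) / (4 * k) - (1 + N.sqrt)) := by
        rw [hcast, Finset.sum_sub_distrib, Finset.sum_const, Nat.card_Icc, Finset.mul_sum,
          nsmul_eq_mul, Nat.add_sub_cancel]
        congr 1
        exact Finset.sum_congr rfl fun k _ => by rw [div_mul_eq_div_div, div_eq_mul_inv _ (k : ℝ)]
    _ ≤ ∑ k ∈ Finset.Icc 1 K,
        (((Finset.Icc 1 N).filter fun n => Squarefree n ∧ k ∣ n + 1).card : ℝ) :=
        Finset.sum_le_sum fun k hk => le_card_squarefree_dvd_succ (Finset.mem_Icc.1 hk).1 N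
    _ = ∑ n ∈ Finset.Icc 1 N,
        (((Finset.Icc 1 K).filter fun k => Squarefree n ∧ k ∣ n + 1).card : ℝ) := by
        simp only [Finset.card_filter, Nat.cast_sum]
        exact Finset.sum_comm
    _ ≤ _ := by
        rw [shiftSum, Nat.floor_natCast]
        refine Finset.sum_le_sum fun n _ => ?_
        refine Nat.cast_le.2 (Finset.card_le_card fun k hk => ?_)
        obtain ⟨-, hn, hkn⟩ := Finset.mem_filter.1 hk
        rw [abelianCount_of_squarefree hn]
        exact Nat.mem_divisors.2 ⟨hkn, n.succ_ne_zero⟩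

lemma harmonic_le_of_shiftSum_le {M : ℝ} (h : ∀ N : ℕ, 0 < N → shiftSum N ≤ M * N) {K : ℕ} (hK : 0 < K) :
    (harmonic K : ℝ) ≤ 4 * (M + 1) := by
  have h1 := (le_shiftSum K (4 * K ^ 2)).trans (h (4 * K ^ 2) (by positivity))
  have hsqrt : (4 * K ^ 2).sqrt = 2 * K := by
    rw [show 4 * K ^ 2 = (2 * K) * (2 * K) by ring, Nat.sqrt_eq]
  rw [hsqrt] at h1
  push_cast at h1
  have hK1 : (1 : ℝ) ≤ K := by exact_mod_cast hK
  have h2 : (K : ℝ) ^ 2 * (harmonic K : ℝ) ≤ K ^ 2 * (4 * (M + 1)) := by nlinarith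
  exact le_of_mul_le_mul_left h2 (by positivity)

lemma tsum_levelLogCoeff_ne_zero : ∑' D, levelLogCoeff D ≠ 0 := by
  intro hA
  obtain ⟨C, hC⟩ := exists_shiftSum_sub_le (ε := 1 / 4) (by norm_num)
  rw [hA] at hC
  have hbound : ∀ N : ℕ, 0 < N → shiftSum N ≤ (∑' D, levelLinCoeff D + C) * N := fun N hN => by
    have h := (abs_le.1 (hC N (by exact_mod_cast hN))).2
    norm_num at h
    linarith
  set M := ∑' D, levelLinCoeff D + C
  obtain ⟨K, hK⟩ := exists_nat_gt (Real.exp (4 * (M + 1)))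
  have h1 := harmonic_le_of_shiftSum_le hbound
    (Nat.cast_pos.1 ((Real.exp_pos _).trans hK))
  have h2 := log_add_one_le_harmonic K
  have h3 : 4 * (M + 1) < Real.log (K + 1) := by
    rw [Real.lt_log_iff_exp_lt (by positivity)]
    linarith
  push_cast at h2
  linarith

end LeadingCoefficient

end DivisorShift

open Filter in
theorem sum_divisorCount_shift :
    ∃ Q : Polynomial ℝ, Q.degree = 1 ∧ ∀ ε : ℝ, 0 < ε →
      (fun x : ℝ =>
          (∑ n ∈ Finset.Icc 1 ⌊x⌋₊, (((n + abelianCount n).divisors.card : ℝ))) -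
            x * Q.eval (Real.log x))
        =O[atTop] fun x : ℝ => x ^ ((3 : ℝ) / 4 + ε) := by
  refine ⟨Polynomial.C (∑' D, DivisorShift.levelLogCoeff D) * Polynomial.X +
    Polynomial.C (∑' D, DivisorShift.levelLinCoeff D),
    Polynomial.degree_linear DivisorShift.tsum_levelLogCoeff_ne_zero, fun ε hε => ?_⟩
  obtain ⟨C, hC⟩ := DivisorShift.exists_shiftSum_sub_le hε
  refine Asymptotics.IsBigO.of_bound C ?_
  filter_upwards [eventually_ge_atTop 1] with x hx
  rw [Real.norm_eq_abs, Real.norm_of_nonneg (by positivity)]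
  simpa [DivisorShift.shiftSum] using hC x hx
end
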